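/- arXiv:0909.2841 — 3 statements merged into one kernel-verified Lean document; each statement's English description precedes it below -/
import Mathlib

section
/- If G is a finitely generated group admitting a surjective homomorphism χ : G → ℤ whose kernel is not finitely generated, then ω(G) ≥ 2^{1/4}. -/
open Filter

/-- The set of elements of `G` expressible as a word of length at most `n`
in elements of `S` and their inverses. -/
def wordBall {G : Type*} [Group G] (S : Finset G) (n : ℕ) : Set G :=
  { g | ∃ l : List G, l.length ≤ n ∧ (∀ x ∈ l, x ∈ S ∨ x⁻¹ ∈ S) ∧ l.prod = g }

/-- `ω(G,S)`: the exponential growth rate of `G` with respect to the finite set `S`,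
i.e. the limit (= limsup, since the limit exists by submultiplicativity) of `γ_S(n)^(1/n)`. -/
noncomputable def growthRate {G : Type*} [Group G] (S : Finset G) : ℝ :=
  Filter.limsup (fun n : ℕ => ((wordBall S n).ncard : ℝ) ^ (1 / (n : ℝ))) Filter.atTop

/-- `ω(G)`: the growth constant of `G`, the infimum of `ω(G,S)` over all finite
generating sets `S` of `G`. -/
noncomputable def growthOmega (G : Type*) [Group G] : ℝ :=
  sInf { r : ℝ | ∃ S : Finset G, Subgroup.closure (S : Set G) = ⊤ ∧ growthRate S = r }


/-- Symmetrized generating set. -/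
def symGen {G : Type*} [Group G] (S : Finset G) : Set G := {x | x ∈ S ∨ x⁻¹ ∈ S}

lemma symGen_inv {G : Type*} [Group G] {S : Finset G} {s : G} (hs : s ∈ symGen S) :
    s⁻¹ ∈ symGen S := by
  rcases hs with h | h
  · right; simpa using h
  · left; exact h

lemma symGen_finite {G : Type*} [Group G] (S : Finset G) : (symGen S).Finite := by
  have h1 : ((S : Set G) ∪ (S : Set G).image (fun x => x⁻¹)).Finite :=
    S.finite_toSet.union (S.finite_toSet.image _)
  refine h1.subset ?_
  rintro x (h | h)
  · left; exact h
  · right; exact ⟨x⁻¹, h, by simp⟩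

/-- Connectedness in the Cayley graph inside the region `P`. -/
def Conn {G : Type*} [Group G] (S : Finset G) (P : G → Prop) : G → G → Prop :=
  Relation.ReflTransGen (fun g h => P g ∧ P h ∧ ∃ s ∈ symGen S, h = g * s)

section conn
variable {G : Type*} [Group G] {S : Finset G}

lemma Conn.mono {P Q : G → Prop} (h : ∀ g, P g → Q g) {a b : G} (hc : Conn S P a b) :
    Conn S Q a b :=
  Relation.ReflTransGen.mono (fun _ _ hh => ⟨h _ hh.1, h _ hh.2.1, hh.2.2⟩) _ _ hc

lemma Conn.symm {P : G → Prop} {a b : G} (hc : Conn S P a b) : Conn S P b a := by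
  induction hc with
  | refl => exact Relation.ReflTransGen.refl
  | @tail x y _ h ih =>
    obtain ⟨hx, hy, s, hs, rfl⟩ := h
    exact Relation.ReflTransGen.head ⟨hy, hx, s⁻¹, symGen_inv hs, by simp⟩ ih

lemma Conn.trans {P : G → Prop} {a b c : G} (h1 : Conn S P a b) (h2 : Conn S P b c) :
    Conn S P a c := Relation.ReflTransGen.trans h1 h2

lemma Conn.step {P : G → Prop} {a s : G} (hs : s ∈ symGen S) (h1 : P a) (h2 : P (a * s)) :
    Conn S P a (a * s) := Relation.ReflTransGen.single ⟨h1, h2, s, hs, rfl⟩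

lemma Conn.translate {P Q : G → Prop} (v : G) (h : ∀ g, P g → Q (v * g)) {a b : G}
    (hc : Conn S P a b) : Conn S Q (v * a) (v * b) := by
  induction hc with
  | refl => exact Relation.ReflTransGen.refl
  | @tail x y _ hh ih =>
    obtain ⟨hx, hy, s, hs, rfl⟩ := hh
    exact Relation.ReflTransGen.tail ih ⟨h _ hx, h _ hy, s, hs, by simp [mul_assoc]⟩

lemma Conn.bound {P : G → Prop} (f : G → ℤ) {a b : G} (hc : Conn S P a b) :
    ∃ C : ℤ, Conn S (fun g => P g ∧ f g ≤ C) a b := by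
  induction hc with
  | refl => exact ⟨0, Relation.ReflTransGen.refl⟩
  | @tail x y _ h ih =>
    obtain ⟨C, hC⟩ := ih
    obtain ⟨hx, hy, s, hs, rfl⟩ := h
    refine ⟨max C (max (f x) (f (x * s))), ?_⟩
    refine Conn.trans (hC.mono ?_) (Conn.step hs ⟨hx, ?_⟩ ⟨hy, ?_⟩)
    · rintro g ⟨h1, h2⟩
      exact ⟨h1, le_max_of_le_left h2⟩
    · simp
    · simp

lemma conn_top (hS : Subgroup.closure (S : Set G) = ⊤) (g : G) :
    Conn S (fun _ => True) 1 g := by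
  have hg : g ∈ Subgroup.closure (S : Set G) := by rw [hS]; trivial
  induction hg using Subgroup.closure_induction with
  | mem x hx =>
    have h : x ∈ symGen S := Or.inl hx
    have := Conn.step (S := S) (P := fun _ => True) (a := 1) h trivial trivial
    simpa using this
  | one => exact Relation.ReflTransGen.refl
  | mul x y _ _ hx hy =>
    refine hx.trans ?_
    simpa using hy.translate x (Q := fun _ => True) (fun _ _ => trivial)
  | inv x _ hx =>
    have := hx.translate x⁻¹ (Q := fun _ => True) (fun _ _ => trivial)
    simpa using this.symm

/-- The positive words in `st` and `ts`. -/
def posWord (s t : G) (l : List Bool) : G :=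
  (l.map (fun b => if b then s * t else t * s)).prod

lemma posWord_cons (s t : G) (b : Bool) (l : List Bool) :
    posWord s t (b :: l) = (if b then s * t else t * s) * posWord s t l := by
  simp [posWord]

lemma exists_rel (s t : G) : ∀ l₁ l₂ : List Bool, l₁.length = l₂.length → l₁ ≠ l₂ →
    posWord s t l₁ = posWord s t l₂ →
    ∃ a b, s * t * posWord s t a = t * s * posWord s t b
  | [], [], _, h, _ => absurd rfl h
  | [], _ :: _, h, _, _ => by simp at h
  | _ :: _, [], h, _, _ => by simp at h
  | b₁ :: l₁, b₂ :: l₂, hl, hne, he => by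
    rw [posWord_cons, posWord_cons] at he
    by_cases hb : b₁ = b₂
    · subst hb
      exact exists_rel s t l₁ l₂ (by simpa using hl) (by simpa using hne) (mul_left_cancel he)
    · cases b₁ <;> cases b₂ <;> simp at hb he
      · exact ⟨l₂, l₁, he.symm⟩
      · exact ⟨l₁, l₂, he⟩

lemma conn_posWord {s t : G} (hs : s ∈ symGen S) (ht : t ∈ symGen S) (f : G → ℤ)
    (hf : ∀ a b, f (a * b) = f a + f b) (hfs : 0 ≤ f s) (hft : 0 < f t) :
    ∀ (l : List Bool) (x : G), 0 < f x → Conn S (fun g => 0 < f g) x (x * posWord s t l)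
  | [], x, _ => by simp only [posWord, List.map_nil, List.prod_nil, mul_one]; exact Relation.ReflTransGen.refl
  | b :: l, x, hx => by
    have hy : 0 < f (x * (if b then s * t else t * s)) := by
      cases b <;> simp [hf] <;> omega
    have := conn_posWord hs ht f hf hfs hft l _ hy
    rw [posWord_cons, ← mul_assoc]
    refine Conn.trans ?_ this
    cases b
    · simp only [Bool.false_eq_true, if_false, ← mul_assoc]
      have h1 : 0 < f (x * t) := by rw [hf]; omega
      exact (Conn.step ht hx h1).trans (Conn.step hs h1 (by rw [hf]; omega))
    · simp only [if_true, ← mul_assoc]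
      have h1 : 0 < f (x * s) := by rw [hf]; omega
      exact (Conn.step hs hx h1).trans (Conn.step ht h1 (by rw [hf]; omega))

lemma push_pos {s t : G} (hs : s ∈ symGen S) (ht : t ∈ symGen S) (f : G → ℤ)
    (hf : ∀ a b, f (a * b) = f a + f b) (hfs : 0 ≤ f s) (hft : 0 < f t)
    (hrel : ∃ a b, s * t * posWord s t a = t * s * posWord s t b) :
    Conn S (fun g => 0 < f g) t (s * t) := by
  obtain ⟨a, b, hab⟩ := hrel
  have h1 : 0 < f (t * s) := by rw [hf]; omega
  have h2 : 0 < f (s * t) := by rw [hf]; omega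
  refine (Conn.step hs hft h1).trans ?_
  refine (conn_posWord hs ht f hf hfs hft b _ h1).trans ?_
  rw [← hab]
  exact (conn_posWord hs ht f hf hfs hft a _ h2).symm

lemma push_one {s t : G} (hs : s ∈ symGen S) (ht : t ∈ symGen S) (f : G → ℤ)
    (hf : ∀ a b, f (a * b) = f a + f b) (hft : 0 < f t)
    (hrel : ∀ s ∈ symGen S, ∃ a b, s * t * posWord s t a = t * s * posWord s t b) :
    Conn S (fun g => min 0 (f s) < f g) t (s * t) := by
  by_cases h : 0 ≤ f s
  · refine (push_pos hs ht f hf h hft (hrel s hs)).mono ?_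
    intro g hg
    exact lt_of_le_of_lt (min_le_left _ _) hg
  · have h1 : f 1 = 0 := by have := hf 1 1; simp at this; omega
    have hi : f s⁻¹ = - f s := by
      have := hf s s⁻¹
      rw [mul_inv_cancel, h1] at this; omega
    have := push_pos (symGen_inv hs) ht f hf (by omega) hft (hrel _ (symGen_inv hs))
    have := this.translate s (Q := fun g => min 0 (f s) < f g)
      (fun g hg => lt_of_le_of_lt (min_le_right _ _) (by rw [hf]; omega))
    simpa using this.symm

lemma exists_push {t : G} (ht : t ∈ symGen S) (f : G → ℤ)
    (hf : ∀ a b, f (a * b) = f a + f b) (hft : 0 < f t)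
    (hrel : ∀ s ∈ symGen S, ∃ a b, s * t * posWord s t a = t * s * posWord s t b) :
    ∃ C : ℤ, 0 ≤ C ∧ ∀ s ∈ symGen S, f s ≤ C ∧
      Conn S (fun g => min 0 (f s) < f g ∧ f g ≤ C) t (s * t) := by
  have h : ∀ s : G, ∃ C : ℤ, s ∈ symGen S → f s ≤ C ∧
      Conn S (fun g => min 0 (f s) < f g ∧ f g ≤ C) t (s * t) := by
    intro s
    by_cases hs : s ∈ symGen S
    · obtain ⟨C, hC⟩ := (push_one hs ht f hf hft hrel).bound f
      exact ⟨max C (f s), fun _ => ⟨le_max_right _ _,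
        hC.mono fun g hg => ⟨hg.1, le_max_of_le_left hg.2⟩⟩⟩
    · exact ⟨0, fun h => absurd h hs⟩
  choose C hC using h
  obtain ⟨B, hB⟩ := ((symGen_finite S).image C).bddAbove
  refine ⟨max B 0, le_max_right _ _, fun s hs => ?_⟩
  have hb : C s ≤ max B 0 := le_max_of_le_left (hB ⟨s, hs, rfl⟩)
  obtain ⟨h1, h2⟩ := hC s hs
  exact ⟨h1.trans hb, h2.mono fun g hg => ⟨hg.1, hg.2.trans hb⟩⟩

/-- Pushing paths up: below a fixed level there is no need to go. -/
lemma push_up {t : G} (ht : t ∈ symGen S) (f : G → ℤ)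
    (hf : ∀ a b, f (a * b) = f a + f b) (hft : 0 < f t)
    (hrel : ∀ s ∈ symGen S, ∃ a b, s * t * posWord s t a = t * s * posWord s t b) :
    ∃ M : ℤ, 0 ≤ M ∧ ∀ b : ℤ, 0 ≤ b → ∀ g : G, 0 ≤ f g → ∀ n : ℕ,
      Conn S (fun x => -(M + n) ≤ f x ∧ f x ≤ b) 1 g →
      Conn S (fun x => -M ≤ f x ∧ f x ≤ b) 1 g := by
  obtain ⟨C, hC0, hC⟩ := exists_push ht f hf hft hrel
  have h1 : f 1 = 0 := by have := hf 1 1; simp at this; omega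
  have hinv : ∀ s : G, f s⁻¹ = - f s := by
    intro s
    have := hf s s⁻¹
    rw [mul_inv_cancel, h1] at this; omega
  have hlow : ∀ s ∈ symGen S, -C ≤ f s := by
    intro s hs
    have := (hC _ (symGen_inv hs)).1
    rw [hinv] at this; omega
  have htC := (hC t ht).1
  refine ⟨2 * C, by omega, fun b hb g hg n => ?_⟩
  induction n with
  | zero => intro h; simpa using h
  | succ n ih =>
    intro h
    apply ih
    classical
    let φ : G → G := fun v => if f v < -C then v * t else v
    have key : ∀ x y, Conn S (fun x => -(2 * C + (n + 1 : ℕ)) ≤ f x ∧ f x ≤ b) x y →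
        Conn S (fun x => -(2 * C + (n : ℕ)) ≤ f x ∧ f x ≤ b) (φ x) (φ y) := by
      intro x y hxy
      induction hxy with
      | refl => exact Relation.ReflTransGen.refl
      | @tail v w _ hs ihs =>
        refine ihs.trans ?_
        obtain ⟨⟨hv1, hv2⟩, ⟨hw1, hw2⟩, s, hs, rfl⟩ := hs
        have e := hf v s
        obtain ⟨hsC, hp⟩ := hC s hs
        have hsl := hlow s hs
        push_cast at hv1 hw1
        have et := hf v t
        have et' := hf (v * s) t
        by_cases c1 : f v < -C <;> by_cases c2 : f (v * s) < -C
        · simp only [φ, c1, c2, if_true]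
          rw [mul_assoc]
          refine hp.translate v ?_
          rintro x ⟨hx1, hx2⟩
          rw [hf]
          omega
        · simp only [φ, c1, c2, if_true, if_false]
          exact (Conn.step ht ⟨by omega, by omega⟩ ⟨by omega, by omega⟩).symm.trans
            (Conn.step hs ⟨by omega, by omega⟩ ⟨by omega, by omega⟩)
        · simp only [φ, c1, c2, if_true, if_false]
          exact (Conn.step hs ⟨by omega, by omega⟩ ⟨by omega, by omega⟩).trans
            (Conn.step ht ⟨by omega, by omega⟩ ⟨by omega, by omega⟩)
        · simp only [φ, c1, c2, if_false]
          exact Conn.step hs ⟨by omega, by omega⟩ ⟨by omega, by omega⟩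
    have := key _ _ h
    have e1 : φ 1 = 1 := by simp only [φ]; rw [if_neg (by omega)]
    have e2 : φ g = g := by simp only [φ]; rw [if_neg (by omega)]
    rwa [e1, e2] at this

lemma exists_strip (hS : Subgroup.closure (S : Set G) = ⊤) (f : G → ℤ)
    (hf : ∀ a b, f (a * b) = f a + f b) (hne : ∃ g, f g ≠ 0)
    (hrel : ∀ t ∈ symGen S, ∀ s ∈ symGen S,
      ∃ a b, s * t * posWord s t a = t * s * posWord s t b) :
    ∃ M : ℤ, ∀ g, f g = 0 → Conn S (fun x => -M ≤ f x ∧ f x ≤ M) 1 g := by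
  have h1 : f 1 = 0 := by have := hf 1 1; simp at this; omega
  have hinv : ∀ s : G, f s⁻¹ = - f s := by
    intro s
    have := hf s s⁻¹
    rw [mul_inv_cancel, h1] at this; omega
  obtain ⟨t, ht, hft⟩ : ∃ t ∈ symGen S, 0 < f t := by
    by_contra! hcon
    have h0 : ∀ t ∈ symGen S, f t = 0 := by
      intro t ht
      have a := hcon t ht
      have b := hcon _ (symGen_inv ht)
      rw [hinv] at b; omega
    obtain ⟨g, hg⟩ := hne
    apply hg
    have := conn_top hS g
    induction this with
    | refl => exact h1
    | @tail v w _ h ih =>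
      obtain ⟨-, -, s, hs, rfl⟩ := h
      by_cases hz : f v = 0
      · rw [hf, h0 s hs, hz]; rfl
      · exact absurd (ih hz) hz
  have ht' := symGen_inv ht
  obtain ⟨M₁, hM₁, H₁⟩ := push_up ht f hf hft (hrel t ht)
  obtain ⟨M₂, hM₂, H₂⟩ := push_up ht' (fun g => - f g) (fun a b => by rw [hf]; omega)
    (by rw [hinv]; omega) (hrel _ ht')
  refine ⟨max M₁ M₂, fun g hg => ?_⟩
  obtain ⟨A, hA⟩ := (conn_top hS g).bound f
  obtain ⟨B, hB⟩ := hA.bound (fun g => - f g)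
  have h2 : Conn S (fun x => -M₁ ≤ f x ∧ f x ≤ max A 0) 1 g := by
    refine H₁ (max A 0) (le_max_right _ _) g (by omega) B.toNat (hB.mono ?_)
    rintro x ⟨⟨-, h⟩, h'⟩
    constructor <;> omega
  have h3 := H₂ M₁ hM₁ g (by omega) (max A 0).toNat (h2.mono (by
    rintro x ⟨h, h'⟩
    constructor <;> omega))
  refine h3.mono ?_
  rintro x ⟨h, h'⟩
  constructor <;> omega

lemma ker_fg (hS : Subgroup.closure (S : Set G) = ⊤) (χ : G →* Multiplicative ℤ)
    (hsurj : Function.Surjective χ)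
    (hrel : ∀ t ∈ symGen S, ∀ s ∈ symGen S,
      ∃ a b, s * t * posWord s t a = t * s * posWord s t b) : χ.ker.FG := by
  let f : G → ℤ := fun g => Multiplicative.toAdd (χ g)
  have hf : ∀ a b, f (a * b) = f a + f b := by intro a b; simp [f]
  have hmem : ∀ g, g ∈ χ.ker ↔ f g = 0 := by
    intro g; rw [MonoidHom.mem_ker]; rfl
  obtain ⟨τ, hτ⟩ := hsurj (Multiplicative.ofAdd 1)
  have hfτ : f τ = 1 := by simp [f, hτ]
  have hfz : ∀ n : ℤ, f (τ ^ n) = n := by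
    intro n; simp [f, hτ]
  have hfi : ∀ g, f g⁻¹ = - f g := by intro g; simp [f]
  obtain ⟨M, hM⟩ := exists_strip hS f hf ⟨τ, by omega⟩ hrel
  rw [Subgroup.fg_iff]
  let gen : ℤ × G → G := fun p => τ ^ p.1 * p.2 * (τ ^ (p.1 + f p.2))⁻¹
  refine ⟨Set.image gen (Set.Icc (-M) M ×ˢ symGen S), ?_,
    ((Set.finite_Icc _ _).prod (symGen_finite S)).image _⟩
  apply le_antisymm
  · rw [Subgroup.closure_le]
    rintro _ ⟨⟨n, s⟩, -, rfl⟩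
    change gen (n, s) ∈ χ.ker
    rw [hmem]
    simp only [gen, hf, hfi, hfz]
    omega
  · intro g hg
    rw [hmem] at hg
    have key : ∀ g, Conn S (fun x => -M ≤ f x ∧ f x ≤ M) 1 g →
        g * (τ ^ (f g))⁻¹ ∈ Subgroup.closure (Set.image gen (Set.Icc (-M) M ×ˢ symGen S)) := by
      intro g hg
      induction hg with
      | refl => 
        have : f 1 = 0 := by simp [f]
        rw [this]; simp
      | @tail v w _ h ih =>
        obtain ⟨hv, -, s, hs, rfl⟩ := h
        have := Subgroup.mul_mem _ ih
          (Subgroup.subset_closure (k := Set.image gen (Set.Icc (-M) M ×ˢ symGen S))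
            ⟨(f v, s), ⟨⟨hv.1, hv.2⟩, hs⟩, rfl⟩)
        convert this using 1
        simp only [gen, hf]
        group
    have := key g (hM g hg)
    rw [hg] at this
    simpa using this

open scoped Pointwise in
lemma wordBall_subset [DecidableEq G] (n : ℕ) :
    wordBall S n ⊆ (((insert 1 (symGen_finite S).toFinset : Finset G) ^ n : Finset G) : Set G) := by
  induction n with
  | zero =>
    rintro g ⟨l, hl, -, rfl⟩
    have : l = [] := by simpa using hl
    simp [this]
  | succ n ih =>
    rintro g ⟨l, hl, hm, rfl⟩
    rw [pow_succ', Finset.coe_mul]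
    cases l with
    | nil =>
      exact ⟨1, by simp, 1, ih ⟨[], by simp, by simp, rfl⟩, by simp⟩
    | cons a l =>
      refine ⟨a, ?_, l.prod, ih ⟨l, by simpa using hl, fun x hx => hm x (by simp [hx]), rfl⟩,
        by simp⟩
      have : a ∈ symGen S := hm a (by simp)
      simp [this]

lemma wordBall_finite (n : ℕ) : (wordBall S n).Finite := by
  classical
  exact (Finset.finite_toSet _).subset (wordBall_subset n)

lemma wordBall_ncard_le : ∃ K : ℕ, ∀ n, (wordBall S n).ncard ≤ K ^ n := by
  classical
  refine ⟨(insert 1 (symGen_finite S).toFinset : Finset G).card, fun n => ?_⟩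
  refine (Set.ncard_le_ncard (wordBall_subset n) (Finset.finite_toSet _)).trans ?_
  rw [Set.ncard_coe_finset]
  exact Finset.card_pow_le

lemma growth_bounded :
    IsBoundedUnder (· ≤ ·) atTop
      (fun n : ℕ => ((wordBall S n).ncard : ℝ) ^ (1 / (n : ℝ))) := by
  obtain ⟨K, hK⟩ := wordBall_ncard_le (S := S)
  refine ⟨(K : ℝ), ?_⟩
  rw [eventually_map]
  filter_upwards [eventually_ge_atTop 1] with n hn
  have h1 : ((wordBall S n).ncard : ℝ) ≤ (K : ℝ) ^ n := by exact_mod_cast hK n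
  calc ((wordBall S n).ncard : ℝ) ^ (1 / (n : ℝ)) ≤ ((K : ℝ) ^ n) ^ (1 / (n : ℝ)) :=
        Real.rpow_le_rpow (by positivity) h1 (by positivity)
    _ = K := by
        rw [one_div]
        exact Real.pow_rpow_inv_natCast (by positivity) (by omega)

lemma posWord_mem {s t : G} (hs : s ∈ symGen S) (ht : t ∈ symGen S) (l : List Bool) :
    posWord s t l ∈ wordBall S (2 * l.length) := by
  induction l with
  | nil => exact ⟨[], by simp, by simp, by simp [posWord]⟩
  | cons b l ih =>
    obtain ⟨w, hw, hm, he⟩ := ih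
    rw [posWord_cons, ← he]
    cases b
    · refine ⟨t :: s :: w, by simp; omega, ?_, by simp [mul_assoc]⟩
      intro x hx
      simp only [List.mem_cons] at hx
      rcases hx with rfl | rfl | hx
      exacts [ht, hs, hm x hx]
    · refine ⟨s :: t :: w, by simp; omega, ?_, by simp [mul_assoc]⟩
      intro x hx
      simp only [List.mem_cons] at hx
      rcases hx with rfl | rfl | hx
      exacts [hs, ht, hm x hx]

lemma ncard_ge {s t : G} (hs : s ∈ symGen S) (ht : t ∈ symGen S)
    (hno : ¬ ∃ a b, s * t * posWord s t a = t * s * posWord s t b) (k : ℕ) :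
    2 ^ k ≤ (wordBall S (2 * k)).ncard := by
  have : Set.ncard (Set.range (fun v : List.Vector Bool k => posWord s t v.1)) = 2 ^ k := by
    rw [← Set.image_univ, Set.ncard_image_of_injective, Set.ncard_univ, Nat.card_eq_fintype_card,
      card_vector, Fintype.card_bool]
    intro v w h
    by_contra hne
    exact hno (exists_rel s t v.1 w.1 (v.2.trans w.2.symm) (fun h => hne (Subtype.ext h)) h)
  rw [← this]
  refine Set.ncard_le_ncard ?_ (wordBall_finite _)
  rintro _ ⟨v, rfl⟩
  have := posWord_mem hs ht v.1
  rwa [v.2] at this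

lemma growth_ge {s t : G} (hs : s ∈ symGen S) (ht : t ∈ symGen S)
    (hno : ¬ ∃ a b, s * t * posWord s t a = t * s * posWord s t b) :
    (2 : ℝ) ^ ((1 : ℝ) / 4) ≤ growthRate S := by
  refine le_limsup_of_frequently_le ?_ growth_bounded
  rw [frequently_atTop]
  intro N
  refine ⟨2 * (N + 1), by omega, ?_⟩
  have h1 : (2 : ℝ) ^ (N + 1) ≤ ((wordBall S (2 * (N + 1))).ncard : ℝ) := by
    exact_mod_cast ncard_ge hs ht hno (N + 1)
  calc (2 : ℝ) ^ ((1 : ℝ) / 4) ≤ (2 : ℝ) ^ ((1 : ℝ) / 2) :=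
        Real.rpow_le_rpow_of_exponent_le (by norm_num) (by norm_num)
    _ = ((2 : ℝ) ^ (N + 1)) ^ (1 / ((2 * (N + 1) : ℕ) : ℝ)) := by
        rw [← Real.rpow_natCast, ← Real.rpow_mul (by norm_num)]
        congr 1
        push_cast
        field_simp
    _ ≤ _ := Real.rpow_le_rpow (by positivity) h1 (by positivity)

end conn

/-- If `G` is a finitely generated group admitting a surjective homomorphism
onto `ℤ` whose kernel is not finitely generated, then `ω(G) ≥ 2^(1/4)`. -/
theorem statement8 {G : Type*} [Group G] (hfg : Group.FG G)
    (χ : G →* Multiplicative ℤ) (hsurj : Function.Surjective χ)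
    (hker : ¬ χ.ker.FG) :
    (2 : ℝ) ^ ((1 : ℝ) / 4) ≤ growthOmega G := by
  refine le_csInf ?_ ?_
  · obtain ⟨S, hS⟩ := hfg.out
    exact ⟨_, S, hS, rfl⟩
  · rintro r ⟨S, hS, rfl⟩
    by_contra hlt
    refine hker (ker_fg hS χ hsurj fun t ht s hs => ?_)
    by_contra hno
    exact hlt (growth_ge hs ht hno)
end

section
/- Let F be a free group (of any rank, possibly infinite) and let G = F ⋊_α ℤ for any automorphism α of F. Then every finitely generated subgroup H of G satisfies ω(H) ≥ 3^{1/6}, unless H is isomorphic to the trivial group, ℤ, ℤ × ℤ, or the Klein bottle group. -/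
open Filter

/-- The single relator `t a t⁻¹ a` of the Klein bottle group `⟨a, t | t a t⁻¹ = a⁻¹⟩`,
with generator `0` playing the role of `a` and generator `1` the role of `t`. -/
def kleinBottleRels : Set (FreeGroup (Fin 2)) :=
  {FreeGroup.of 1 * FreeGroup.of 0 * (FreeGroup.of 1)⁻¹ * FreeGroup.of 0}

/-- The Klein bottle group `⟨a, t | t a t⁻¹ = a⁻¹⟩`. -/
abbrev KleinBottleGroup : Type := PresentedGroup kleinBottleRels
/-- The action of `Multiplicative ℤ` on `K` whose generator acts by the automorphism `α`. -/
def zAction {K : Type*} [Group K] (α : MulAut K) : Multiplicative ℤ →* MulAut K where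
  toFun n := α ^ (Multiplicative.toAdd n)
  map_one' := by simp
  map_mul' m n := by simp [zpow_add]

/-- The semidirect product `K ⋊_α ℤ`, i.e. the non-proper HNN extension of `K` by `α`. -/
abbrev zSemidirect (K : Type*) [Group K] (α : MulAut K) :=
  SemidirectProduct K (Multiplicative ℤ) (zAction α)

namespace FreeAux

universe u

/-- Free groups are residually finite. -/
lemma exists_finite_quotient {α : Type u} (g : FreeGroup α) (hg : g ≠ 1) :
    ∃ (V : Type u) (_ : Finite V) (φ : FreeGroup α →* Equiv.Perm V), φ g ≠ 1 := by
  classical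
  obtain ⟨w, rfl⟩ : ∃ w, FreeGroup.mk w = g := ⟨g.toWord, FreeGroup.mk_toWord⟩
  let P : FreeGroup α → Prop := fun v => ∃ s, s <:+ w ∧ FreeGroup.mk s = v
  have hfin : Finite {v // P v} := by
    have : {v | P v}.Finite := by
      have h2 : {v | P v} ⊆ FreeGroup.mk '' {s | s ∈ w.tails} := by
        rintro v ⟨s, hs, rfl⟩
        exact ⟨s, by simpa using hs, rfl⟩
      exact ((List.finite_toSet _).image _).subset h2
    exact this
  have := Fintype.ofFinite {v // P v}
  let e : ∀ x : α, {v : {v // P v} // P (FreeGroup.of x * v.1)} ≃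
      {v : {v // P v} // P ((FreeGroup.of x)⁻¹ * v.1)} := fun x =>
    { toFun := fun v => ⟨⟨FreeGroup.of x * v.1.1, v.2⟩, by simpa using v.1.2⟩
      invFun := fun v => ⟨⟨(FreeGroup.of x)⁻¹ * v.1.1, v.2⟩, by simpa using v.1.2⟩
      left_inv := fun v => by simp
      right_inv := fun v => by simp }
  let σ : α → Equiv.Perm {v // P v} := fun x => (e x).extendSubtype
  have hσ : ∀ x (v : {v // P v}) (h : P (FreeGroup.of x * v.1)),
      σ x v = ⟨FreeGroup.of x * v.1, h⟩ := fun x v h =>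
    (e x).extendSubtype_apply_of_mem v h
  have h1 : P 1 := ⟨[], List.nil_suffix, rfl⟩
  have key : ∀ s, (hs : s <:+ w) →
      FreeGroup.lift σ (FreeGroup.mk s) ⟨1, h1⟩ = ⟨FreeGroup.mk s, s, hs, rfl⟩ := by
    intro s
    induction s with
    | nil => intro hs; exact congrArg (fun h : Equiv.Perm {v // P v} => h ⟨1, h1⟩) (map_one (FreeGroup.lift σ))
    | cons a s ih =>
      intro hs
      have hs' : s <:+ w := (List.suffix_cons a s).trans hs
      have hm : FreeGroup.mk (a :: s) = FreeGroup.mk [a] * FreeGroup.mk s := by simp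
      obtain ⟨x, b⟩ := a
      have ihs := ih hs'
      have hP : P (FreeGroup.mk ((x, b) :: s)) := ⟨_, hs, rfl⟩
      cases b with
      | true =>
        have hx : FreeGroup.mk [(x, true)] = FreeGroup.of x := rfl
        simp only [hm, hx] at hP ⊢
        rw [map_mul, Equiv.Perm.mul_apply, ihs, FreeGroup.lift_apply_of]
        exact hσ x _ hP
      | false =>
        have hx : FreeGroup.mk [(x, false)] = (FreeGroup.of x)⁻¹ := by
          simp [FreeGroup.of, FreeGroup.invRev]
        simp only [hm, hx] at hP ⊢
        rw [map_mul, Equiv.Perm.mul_apply, ihs, map_inv, FreeGroup.lift_apply_of,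
          Equiv.Perm.inv_eq_iff_eq, hσ x ⟨_, hP⟩ (by simpa using ⟨s, hs', rfl⟩)]
        simp
  refine ⟨_, hfin, FreeGroup.lift σ, fun h => hg ?_⟩
  have := key w List.suffix_rfl
  rw [h] at this
  simpa using (congrArg Subtype.val this).symm

/-- Finitely generated free groups are Hopfian. -/
lemma hopfian {ι : Type*} [Finite ι] (f : FreeGroup ι →* FreeGroup ι)
    (hf : Function.Surjective f) : Function.Injective f := by
  rw [injective_iff_map_eq_one]
  intro g hg
  by_contra hne
  obtain ⟨V, hV, φ, hφ⟩ := exists_finite_quotient g hne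
  have : Finite (FreeGroup ι →* Equiv.Perm V) := Finite.of_equiv _ FreeGroup.lift
  have hinj : Function.Injective (fun ψ : FreeGroup ι →* Equiv.Perm V => ψ.comp f) := by
    intro a b h
    ext x : 1
    obtain ⟨y, hy⟩ := hf (FreeGroup.of x)
    rw [← hy]
    exact DFunLike.congr_fun h y
  obtain ⟨ψ, hψ⟩ := (Finite.injective_iff_surjective.1 hinj) φ
  apply hφ
  rw [← hψ]
  simp [hg]

lemma isCyclic_of_subsingleton (X : Type*) [Subsingleton X] : IsCyclic (FreeGroup X) := by
  rcases isEmpty_or_nonempty X with h | ⟨⟨x⟩⟩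
  · infer_instance
  · refine ⟨FreeGroup.of x, fun g => ?_⟩
    have h := FreeGroup.closure_range_of X
    have h2 : Set.range (FreeGroup.of (α := X)) = {FreeGroup.of x} := by
      ext y; constructor
      · rintro ⟨z, rfl⟩; rw [Subsingleton.elim z x]; rfl
      · rintro rfl; exact ⟨x, rfl⟩
    rw [h2, ← Subgroup.zpowers_eq_closure] at h
    have hg : g ∈ Subgroup.zpowers (FreeGroup.of x) := by rw [h]; trivial
    exact hg

lemma isCyclic_of_comm {L : Type*} [Group L] [IsFreeGroup L] (h : ∀ a b : L, Commute a b) :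
    IsCyclic L := by
  classical
  have : Subsingleton (IsFreeGroup.Generators L) := by
    constructor
    intro x y
    by_contra hne
    let φ : L →* Equiv.Perm (Fin 3) := IsFreeGroup.lift (fun z => if z = x then Equiv.swap 0 1 else Equiv.swap 1 2)
    have h1 := (h (IsFreeGroup.of x) (IsFreeGroup.of y)).map φ
    have hx : φ (IsFreeGroup.of x) = Equiv.swap 0 1 := by simp [φ]
    have hy : φ (IsFreeGroup.of y) = Equiv.swap 1 2 := by simp [φ, Ne.symm hne]
    rw [hx, hy] at h1
    revert h1
    unfold Commute SemiconjBy
    decide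
  have := isCyclic_of_subsingleton (IsFreeGroup.Generators L)
  exact isCyclic_of_surjective (IsFreeGroup.toFreeGroup L).symm (IsFreeGroup.toFreeGroup L).symm.surjective

/-- Two non-commuting elements of a free group freely generate a free group. -/
lemma free_pair {L : Type*} [Group L] [IsFreeGroup L] (u v : L) (h : ¬ Commute u v) :
    Function.Injective (FreeGroup.lift ![u, v]) := by
  set f := FreeGroup.lift ![u, v] with hf
  let X := IsFreeGroup.Generators f.range
  let e : f.range ≃* FreeGroup X := IsFreeGroup.toFreeGroup f.range
  let f' : FreeGroup (Fin 2) →* FreeGroup X := e.toMonoidHom.comp f.rangeRestrict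
  have hf' : Function.Surjective f' := e.surjective.comp f.rangeRestrict_surjective
  let Z := Multiplicative (ZMod 2)
  have hinj : Function.Injective (fun (g : X → Z) (i : Fin 2) => FreeGroup.lift g (f' (FreeGroup.of i))) := by
    intro a b hab
    have h1 : (FreeGroup.lift a).comp f' = (FreeGroup.lift b).comp f' := by
      ext i : 1
      exact congrFun hab i
    have h2 : FreeGroup.lift a = FreeGroup.lift b := by
      ext x : 1
      obtain ⟨y, hy⟩ := hf' (FreeGroup.of x)
      rw [← hy]
      exact DFunLike.congr_fun h1 y
    exact FreeGroup.lift.injective h2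
  have : Finite Z := inferInstanceAs (Finite (ZMod 2))
  have hcZ : Nat.card Z = 2 := Nat.card_zmod 2
  have hfinZ : Finite (X → Z) := Finite.of_injective _ hinj
  have hfinX : Finite X := by
    classical
    refine Finite.of_injective (fun x : X => (Pi.mulSingle x (Multiplicative.ofAdd (1 : ZMod 2)) : X → Z)) ?_
    intro x y hxy
    by_contra hne
    have h1 := congrFun hxy x
    simp only [Pi.mulSingle_eq_same, Pi.mulSingle_eq_of_ne hne] at h1
    revert h1
    decide
  have hcard : Nat.card X ≤ 2 := by
    have := Nat.card_le_card_of_injective _ hinj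
    rw [Nat.card_fun, Nat.card_fun, hcZ] at this
    simpa using (Nat.pow_le_pow_iff_right (by norm_num)).1 this
  have hcard2 : Nat.card X = 2 := by
    by_contra hne
    have hle : Nat.card X ≤ 1 := by omega
    have : Subsingleton X := Finite.card_le_one_iff_subsingleton.1 hle
    have := isCyclic_of_subsingleton X
    apply h
    have hc : Commute (f' (FreeGroup.of 0)) (f' (FreeGroup.of 1)) := by
      let _ := IsCyclic.commGroup (α := FreeGroup X)
      exact Commute.all (S := FreeGroup X) _ _
    have h3 : Commute (f.rangeRestrict (FreeGroup.of 0)) (f.rangeRestrict (FreeGroup.of 1)) := by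
      have := hc.map e.symm
      simpa [f'] using this
    have h4 := h3.map f.range.subtype
    simpa [hf] using h4
  have eX : X ≃ Fin 2 := (Finite.equivFin X).trans (finCongr hcard2)
  let f'' : FreeGroup (Fin 2) →* FreeGroup (Fin 2) := (FreeGroup.freeGroupCongr eX).toMonoidHom.comp f'
  have hs : Function.Surjective f'' := (FreeGroup.freeGroupCongr eX).surjective.comp hf'
  have hi := hopfian f'' hs
  intro a b hab
  apply hi
  have : f.rangeRestrict a = f.rangeRestrict b := Subtype.ext hab
  simp [f'', f', this]

section
variable {L : Type*} [Group L] [IsFreeGroup L]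

lemma exists_zpow (a b : L) (h : Commute a b) : ∃ (p : L) (i j : ℤ), a = p ^ i ∧ b = p ^ j := by
  let M := Subgroup.closure ({a, b} : Set L)
  have hM : IsMulCommutative M := Subgroup.isMulCommutative_closure (by
    rintro x (rfl | rfl) y (rfl | rfl) <;> first | rfl | exact h | exact h.symm)
  have : IsCyclic M := isCyclic_of_comm (fun a b => hM.is_comm.comm a b)
  obtain ⟨p, hp⟩ := this
  obtain ⟨i, hi⟩ := hp ⟨a, Subgroup.subset_closure (by simp)⟩
  obtain ⟨j, hj⟩ := hp ⟨b, Subgroup.subset_closure (by simp)⟩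
  exact ⟨p, i, j, by simpa using (congrArg Subtype.val hi).symm,
    by simpa using (congrArg Subtype.val hj).symm⟩

lemma commute_trans {a b d : L} (ha : a ≠ 1) (hb : Commute a b) (hd : Commute a d) :
    Commute b d := by
  obtain ⟨p, i, j, h1, rfl⟩ := exists_zpow a b hb
  obtain ⟨q, k, l, h2, rfl⟩ := exists_zpow a d hd
  suffices Commute p q from (this.zpow_zpow j l)
  by_contra hne
  have hi := free_pair p q hne
  have h3 : (FreeGroup.of 0 : FreeGroup (Fin 2)) ^ i = FreeGroup.of 1 ^ k := by
    apply hi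
    simp [← h1, ← h2]
  have h4 := congrArg (FreeGroup.lift ![Multiplicative.ofAdd (1 : ℤ), 1]) h3
  have hi0 : i = 0 := by
    simpa [← ofAdd_zsmul] using h4
  exact ha (by simp [h1, hi0])

lemma commute_of_conj {k c : L} (h : Commute (k * c * k⁻¹) c) : Commute k c := by
  by_contra hne
  have hi := free_pair k c hne
  have h3 : Commute ((FreeGroup.of 0 : FreeGroup (Fin 2)) * FreeGroup.of 1 * (FreeGroup.of 0)⁻¹)
      (FreeGroup.of 1) := by
    apply hi
    simpa using h.eq
  have h4 : ∀ a b : Equiv.Perm (Fin 3), Commute (a * b * a⁻¹) b := by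
    intro a b
    simpa using h3.map (FreeGroup.lift ![a, b])
  have := h4 (Equiv.swap 0 1) (Equiv.swap 1 2)
  revert this
  unfold Commute SemiconjBy
  decide

lemma zpow_eq_one {p : L} (hp : p ≠ 1) {n : ℤ} (h : p ^ n = 1) : n = 0 := by
  by_contra hn
  have h1 : (IsFreeGroup.toFreeGroup L p) ^ n = 1 := by rw [← map_zpow, h, map_one]
  have := (IsMulTorsionFree.zpow_eq_one_iff_left hn).1 h1
  exact hp (by simpa using this)
end

end FreeAux

namespace FreeAux

/-- The `i`-th letter that does not cancel against `h`. -/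
def nxt (h : Fin 2 × Bool) (i : Fin 3) : Fin 2 × Bool :=
  if i = 0 then h else if i = 1 then (h.1 + 1, true) else (h.1 + 1, false)

/-- Encoding of words in three letters as reduced words. -/
def enc : List (Fin 3) → List (Fin 2 × Bool)
  | [] => []
  | i :: l => nxt ((enc l).headD (0, true)) i :: enc l

lemma nxt_inj : ∀ h, Function.Injective (nxt h) := by
  unfold Function.Injective
  decide

lemma nxt_red : ∀ h i, (nxt h i).1 = h.1 → (nxt h i).2 = h.2 := by decide

lemma enc_length (l : List (Fin 3)) : (enc l).length = l.length := by
  induction l with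
  | nil => rfl
  | cons i l ih => simp [enc, ih]

lemma enc_inj : Function.Injective enc := by
  intro l
  induction l with
  | nil =>
    intro m h
    cases m with
    | nil => rfl
    | cons j m => simp [enc] at h
  | cons i l ih =>
    intro m h
    cases m with
    | nil => simp [enc] at h
    | cons j m =>
      simp only [enc, List.cons.injEq] at h
      obtain rfl := ih h.2
      rw [nxt_inj _ h.1]

lemma enc_reduced (l : List (Fin 3)) : FreeGroup.IsReduced (enc l) := by
  induction l with
  | nil => exact FreeGroup.IsReduced.nil
  | cons i l ih =>
    rw [enc]
    cases h : enc l with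
    | nil => exact FreeGroup.IsReduced.singleton
    | cons a L =>
      rw [FreeGroup.isReduced_cons_cons]
      exact ⟨nxt_red _ _, h ▸ ih⟩

lemma mk_enc_inj : Function.Injective (fun l => FreeGroup.mk (enc l)) := by
  intro l m h
  apply enc_inj
  have h2 := congrArg FreeGroup.toWord h
  simpa [FreeGroup.toWord_mk, (enc_reduced _).reduce_eq] using h2

section
variable {G : Type*} [Group G] {S : Finset G}

lemma wordBall_mul {m n : ℕ} {g h : G} (hg : g ∈ wordBall S m) (hh : h ∈ wordBall S n) :
    g * h ∈ wordBall S (m + n) := by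
  obtain ⟨l, h1, h2, rfl⟩ := hg
  obtain ⟨l', h1', h2', rfl⟩ := hh
  refine ⟨l ++ l', by simp; omega, ?_, by simp⟩
  intro x hx
  rcases List.mem_append.1 hx with hx | hx
  · exact h2 x hx
  · exact h2' x hx

lemma wordBall_inv {m : ℕ} {g : G} (hg : g ∈ wordBall S m) : g⁻¹ ∈ wordBall S m := by
  obtain ⟨l, h1, h2, rfl⟩ := hg
  refine ⟨(l.map (·⁻¹)).reverse, by simpa, ?_, by rw [List.prod_inv_reverse]⟩
  intro x hx
  simp only [List.mem_reverse, List.mem_map] at hx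
  obtain ⟨y, hy, rfl⟩ := hx
  simpa using (h2 y hy).symm

lemma wordBall_of_mem {g : G} (hg : g ∈ S) : g ∈ wordBall S 1 :=
  ⟨[g], by simp, by simpa using Or.inl hg, by simp⟩

lemma wordBall_one : (1 : G) ∈ wordBall S 0 := ⟨[], by simp, by simp, rfl⟩

lemma wordBall_bound (S : Finset G) : ∃ C : ℕ, ∀ n, (wordBall S n).Finite ∧ (wordBall S n).ncard ≤ C ^ n := by
  classical
  let T : Finset G := insert 1 (S ∪ S.image (·⁻¹))
  refine ⟨T.card, fun n => ?_⟩
  let f : (Fin n → T) → G := fun x => (List.ofFn (fun i => (x i : G))).prod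
  have hsub : wordBall S n ⊆ Set.range f := by
    rintro g ⟨l, h1, h2, rfl⟩
    have hT : ∀ i : Fin n, l.getD i 1 ∈ T := by
      intro i
      rw [List.getD_eq_getElem?_getD]
      by_cases hi : (i : ℕ) < l.length
      · rw [List.getElem?_eq_getElem hi]
        simp only [Option.getD_some]
        rcases h2 _ (List.getElem_mem hi) with h | h
        · simp [T, h]
        · simp only [T, Finset.mem_insert, Finset.mem_union, Finset.mem_image]
          exact Or.inr (Or.inr ⟨_, h, by simp⟩)
      · rw [List.getElem?_eq_none (by omega)]
        simp [T]
    refine ⟨fun i => ⟨l.getD i 1, hT i⟩, ?_⟩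
    have : List.ofFn (fun i : Fin n => l.getD i 1) = l ++ List.replicate (n - l.length) 1 := by
      apply List.ext_getElem
      · simp; omega
      · intro i h3 h4
        simp only [List.getElem_ofFn, List.getD_eq_getElem?_getD]
        by_cases hi : i < l.length
        · simp [hi]
        · rw [List.getElem?_eq_none (by omega), List.getElem_append_right (by omega)]
          simp
    simp only [f]
    rw [this]
    simp
  have hfin : (Set.range f).Finite := Set.finite_range f
  refine ⟨hfin.subset hsub, (Set.ncard_le_ncard hsub hfin).trans ?_⟩
  have h5 := Finite.card_range_le f
  rw [Nat.card_coe_set_eq] at h5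
  simpa using h5

lemma lift_mem_wordBall {c d : G} {k : ℕ} (hc : c ∈ wordBall S k) (hd : d ∈ wordBall S k)
    (L : List (Fin 2 × Bool)) :
    FreeGroup.lift ![c, d] (FreeGroup.mk L) ∈ wordBall S (k * L.length) := by
  induction L with
  | nil =>
    rw [← FreeGroup.one_eq_mk, map_one]
    exact wordBall_one
  | cons a L ih =>
    have hm : FreeGroup.mk (a :: L) = FreeGroup.mk [a] * FreeGroup.mk L := by simp
    rw [hm, map_mul, List.length_cons, Nat.mul_succ, add_comm]
    refine wordBall_mul ?_ ih
    obtain ⟨x, b⟩ := a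
    have hx : ![c, d] x ∈ wordBall S k := by
      fin_cases x
      · exact hc
      · exact hd
    cases b with
    | true => simpa using hx
    | false => simpa using wordBall_inv hx

lemma growthRate_ge {c d : G} (hc : c ∈ wordBall S 6) (hd : d ∈ wordBall S 6)
    (hinj : Function.Injective (FreeGroup.lift ![c, d])) :
    (3 : ℝ) ^ ((1 : ℝ) / 6) ≤ growthRate S := by
  obtain ⟨C, hC⟩ := wordBall_bound S
  have hlow : ∀ n, 3 ^ n ≤ (wordBall S (6 * n)).ncard := by
    intro n
    let f : (Fin n → Fin 3) → G := fun x =>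
      FreeGroup.lift ![c, d] (FreeGroup.mk (enc (List.ofFn x)))
    have hf : Function.Injective f := by
      intro x y h
      exact List.ofFn_injective (mk_enc_inj (hinj h))
    have hsub : Set.range f ⊆ wordBall S (6 * n) := by
      rintro _ ⟨x, rfl⟩
      have := lift_mem_wordBall hc hd (enc (List.ofFn x))
      rwa [enc_length, List.length_ofFn] at this
    have h1 := Set.ncard_le_ncard hsub (hC _).1
    rw [← Nat.card_coe_set_eq, Nat.card_range_of_injective hf] at h1
    simpa using h1
  unfold growthRate
  refine Filter.le_limsup_of_frequently_le ?_ ?_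
  · rw [Filter.frequently_atTop]
    intro N
    refine ⟨6 * (N + 1), by omega, ?_⟩
    have h1 : ((3 : ℝ) ^ (N + 1)) ≤ ((wordBall S (6 * (N + 1))).ncard : ℝ) := by
      exact_mod_cast hlow (N + 1)
    calc (3 : ℝ) ^ ((1 : ℝ) / 6)
        = ((3 : ℝ) ^ (N + 1)) ^ (1 / ((6 * (N + 1) : ℕ) : ℝ)) := by
          rw [← Real.rpow_natCast, ← Real.rpow_mul (by norm_num)]
          congr 1
          push_cast
          field_simp
      _ ≤ _ := Real.rpow_le_rpow (by positivity) h1 (by positivity)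
  · refine ⟨max (C : ℝ) 1, ?_⟩
    rw [Filter.eventually_map]
    refine Filter.Eventually.of_forall fun n => ?_
    rcases Nat.eq_zero_or_pos n with rfl | hn
    · simp
    · refine le_trans ?_ (le_max_left _ _)
      have h1 : ((wordBall S n).ncard : ℝ) ≤ (C : ℝ) ^ n := by exact_mod_cast (hC n).2
      calc _ ≤ ((C : ℝ) ^ n) ^ (1 / (n : ℝ)) :=
            Real.rpow_le_rpow (by positivity) h1 (by positivity)
        _ = C := by
          rw [one_div, Real.pow_rpow_inv_natCast (by positivity) (by omega)]
end

/-- In a group with free normal subgroup `K` with abelian quotient, small growth forces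
`K` to be abelian. -/
lemma kernel_comm {H : Type*} [Group H] (π : H →* Multiplicative ℤ) [IsFreeGroup π.ker]
    (S : Finset H) (hS : Subgroup.closure (S : Set H) = ⊤)
    (hg : growthRate S < (3 : ℝ) ^ ((1 : ℝ) / 6)) (a b : π.ker) : Commute a b := by
  by_cases hab : ∀ s ∈ S, ∀ t ∈ S, Commute s t
  · have hM : IsMulCommutative (Subgroup.closure (S : Set H)) :=
      Subgroup.isMulCommutative_closure (fun x hx y hy => hab x hx y hy)
    have h1 := hM.is_comm.comm ⟨a.1, hS ▸ Subgroup.mem_top _⟩ ⟨b.1, hS ▸ Subgroup.mem_top _⟩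
    have h2 := congrArg Subtype.val h1
    exact Subtype.ext h2
  push Not at hab
  obtain ⟨s, hs, t, ht, hst⟩ := hab
  have hker : ∀ (h : H) (c : π.ker), h * c.1 * h⁻¹ ∈ π.ker := fun h c =>
    (MonoidHom.normal_ker π).conj_mem _ c.2 h
  let cj : H → π.ker → π.ker := fun h c => ⟨h * c.1 * h⁻¹, hker h c⟩
  have cj_mul : ∀ g h c, cj (g * h) c = cj g (cj h c) := by
    intro g h c; apply Subtype.ext; simp [cj, mul_assoc]
  have cj_one : ∀ h c, cj h c = 1 → c = 1 := by
    intro h c hc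
    have := congrArg Subtype.val hc
    apply Subtype.ext
    simpa [cj] using this
  have cj_comm : ∀ h c d, Commute c d → Commute (cj h c) (cj h d) := by
    intro h c d hcd
    have h1 : c.1 * d.1 = d.1 * c.1 := congrArg Subtype.val hcd.eq
    apply Subtype.ext
    simp only [cj, Subgroup.coe_mul]
    calc h * c.1 * h⁻¹ * (h * d.1 * h⁻¹) = h * (c.1 * d.1) * h⁻¹ := by group
      _ = _ := by rw [h1]; group
  let c : π.ker := ⟨s * t * s⁻¹ * t⁻¹, by
    rw [MonoidHom.mem_ker]; simp only [map_mul, map_inv]; rw [mul_comm (π s)]; simp⟩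
  have hc1 : c ≠ 1 := by
    intro h
    have h1 : s * t * s⁻¹ * t⁻¹ = 1 := congrArg Subtype.val h
    apply hst
    rw [mul_inv_eq_one, mul_inv_eq_iff_eq_mul] at h1
    exact h1
  have bs := wordBall_of_mem hs
  have bt := wordBall_of_mem ht
  have bc : c.1 ∈ wordBall S 4 :=
    wordBall_mul (wordBall_mul (wordBall_mul bs bt) (wordBall_inv bs)) (wordBall_inv bt)
  have bc6 : c.1 ∈ wordBall S 6 := by
    simpa using wordBall_mul bc (show (1 : H) ∈ wordBall S 2 from ⟨[], by simp, by simp, rfl⟩)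
  have hcomm : ∀ r ∈ S, Commute (cj r c) c := by
    intro r hr
    by_contra hne
    have hi := free_pair _ _ hne
    have hd : (cj r c).1 ∈ wordBall S 6 := 
      wordBall_mul (wordBall_mul (wordBall_of_mem hr) bc) (wordBall_inv (wordBall_of_mem hr))
    refine absurd (growthRate_ge hd bc6 ?_) (not_le.2 hg)
    have heq : FreeGroup.lift ![(cj r c).1, c.1] =
        π.ker.subtype.comp (FreeGroup.lift ![cj r c, c]) := by
      ext i
      fin_cases i <;> simp
    rw [heq]
    exact π.ker.subtype_injective.comp hi
  have hall : ∀ h : H, Commute (cj h c) c := by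
    intro h
    have hh : h ∈ Subgroup.closure (S : Set H) := hS ▸ Subgroup.mem_top _
    induction hh using Subgroup.closure_induction with
    | mem x hx => exact hcomm x hx
    | one =>
      have : cj 1 c = c := by apply Subtype.ext; simp [cj]
      rw [this]
    | mul g h _ _ h1 h2 =>
      rw [cj_mul]
      exact commute_trans (a := cj g c) (fun h => hc1 (cj_one _ _ h)) (cj_comm g _ _ h2).symm h1
    | inv g _ h1 =>
      have h2 := cj_comm g⁻¹ _ _ h1
      rw [← cj_mul] at h2
      have : cj (g⁻¹ * g) c = c := by apply Subtype.ext; simp [cj]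
      rw [this] at h2
      exact h2.symm
  have hk : ∀ k : π.ker, Commute c k := by
    intro k
    exact (commute_of_conj (k := k) (hall k.1)).symm
  exact commute_trans hc1 (hk a) (hk b)

end FreeAux

namespace FreeAux

/-- Normal form in the Klein bottle group. -/
lemma klein_normal_form (x : KleinBottleGroup) : ∃ i j : ℤ,
    x = PresentedGroup.of (rels := kleinBottleRels) 0 ^ i * PresentedGroup.of 1 ^ j := by
  set a := PresentedGroup.of (rels := kleinBottleRels) 0 with ha
  set t := PresentedGroup.of (rels := kleinBottleRels) 1 with ht
  have hrel : t * a * t⁻¹ * a = 1 := by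
    have := PresentedGroup.one_of_mem (rels := kleinBottleRels) (x := FreeGroup.of 1 * FreeGroup.of 0 * (FreeGroup.of 1)⁻¹ * FreeGroup.of 0) rfl
    exact this
  have h1 : t * a * t⁻¹ = a⁻¹ := eq_inv_of_mul_eq_one_left hrel
  have hti : ∀ i : ℤ, t * a ^ i = a ^ (-i) * t := by
    intro i
    have : t * a ^ i * t⁻¹ = a ^ (-i) := by rw [← conj_zpow, h1]; simp
    rw [← this]; simp
  have hti' : ∀ i : ℤ, t⁻¹ * a ^ i = a ^ (-i) * t⁻¹ := by
    intro i
    have := hti (-i)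
    rw [neg_neg] at this
    rw [inv_mul_eq_iff_eq_mul, ← mul_assoc, this]; simp
  have hx : x ∈ Subgroup.closure (Set.range (PresentedGroup.of (rels := kleinBottleRels))) := by
    rw [PresentedGroup.closure_range_of]; trivial
  induction hx using Subgroup.closure_induction_left with
  | one => exact ⟨0, 0, by simp⟩
  | mul_left y hy z _ ih =>
    obtain ⟨k, rfl⟩ := hy
    obtain ⟨i, j, rfl⟩ := ih
    fin_cases k
    · exact ⟨1 + i, j, by simp [zpow_add, mul_assoc, ← ha]⟩
    · exact ⟨-i, 1 + j, by
        simp only [Fin.mk_one, ← ht]; rw [← mul_assoc, hti, zpow_add, zpow_one, mul_assoc]⟩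
  | inv_mul_cancel y hy z _ ih =>
    obtain ⟨k, rfl⟩ := hy
    obtain ⟨i, j, rfl⟩ := ih
    fin_cases k
    · exact ⟨-1 + i, j, by simp [zpow_add, mul_assoc, ← ha]⟩
    · exact ⟨-i, -1 + j, by
        simp only [Fin.mk_one, ← ht]
        rw [← mul_assoc, hti', zpow_add, zpow_neg_one, mul_assoc]⟩

lemma classify {H : Type*} [Group H] (π : H →* Multiplicative ℤ) [IsFreeGroup π.ker]
    (hcomm : ∀ a b : π.ker, Commute a b) :
    Subsingleton H ∨ Nonempty (H ≃* Multiplicative ℤ) ∨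
    Nonempty (H ≃* Multiplicative (ℤ × ℤ)) ∨ Nonempty (H ≃* KleinBottleGroup) := by
  -- a generator of the kernel
  obtain ⟨p, hp⟩ := isCyclic_of_comm hcomm
  have hpker : ∀ n : ℤ, π (p.1 ^ n) = 1 := fun n => by
    have : π p.1 = 1 := p.2
    simp [this]
  -- a generator of the image
  obtain ⟨⟨_, t, rfl⟩, ht⟩ : IsCyclic π.range := inferInstance
  have hform : ∀ h : H, ∃ i j : ℤ, h = p.1 ^ i * t ^ j := by
    intro h
    obtain ⟨j, hj⟩ := ht ⟨π h, h, rfl⟩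
    have hj' : π t ^ j = π h := by simpa using congrArg Subtype.val hj
    obtain ⟨i, hi⟩ := hp ⟨h * (t ^ j)⁻¹, by simp [MonoidHom.mem_ker, hj']⟩
    have hi' : p.1 ^ i = h * (t ^ j)⁻¹ := by simpa using congrArg Subtype.val hi
    exact ⟨i, j, by simp [hi']⟩
  have pinf : p ≠ 1 → ∀ i : ℤ, p.1 ^ i = 1 → i = 0 := by
    intro h i hi
    exact zpow_eq_one h (Subtype.ext (by simpa using hi))
  have tinf : π t ≠ 1 → ∀ j : ℤ, π t ^ j = 1 → j = 0 := by
    intro h j hj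
    have h1 : j • (π t).toAdd = 0 := by rw [← toAdd_zpow, hj]; rfl
    rcases smul_eq_zero.1 h1 with h2 | h2
    · exact h2
    · exact absurd h2 h
  by_cases hp1 : p = 1
  · by_cases ht1 : π t = 1
    · left
      have : ∀ h : H, h = 1 := by
        intro h
        have hk : h ∈ π.ker := by
          obtain ⟨i, j, rfl⟩ := hform h
          rw [MonoidHom.mem_ker, map_mul, hpker, map_zpow, ht1]; simp
        obtain ⟨i, hi⟩ := hp ⟨h, hk⟩
        have := congrArg Subtype.val hi
        simpa [hp1] using this.symm
      exact ⟨fun a b => by rw [this a, this b]⟩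
    · right; left
      refine ⟨(MulEquiv.ofBijective (zpowersHom H t) ⟨?_, ?_⟩).symm⟩
      · rw [injective_iff_map_eq_one]
        intro n hn
        have : π t ^ n.toAdd = 1 := by
          rw [← map_zpow]; rw [zpowersHom_apply] at hn; rw [hn, map_one]
        exact tinf ht1 _ this
      · intro h
        obtain ⟨i, j, rfl⟩ := hform h
        exact ⟨Multiplicative.ofAdd j, by simp [hp1]⟩
  · by_cases ht1 : π t = 1
    · right; left
      refine ⟨(MulEquiv.ofBijective (zpowersHom H p.1) ⟨?_, ?_⟩).symm⟩
      · rw [injective_iff_map_eq_one]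
        intro n hn
        rw [zpowersHom_apply] at hn
        exact pinf hp1 _ hn
      · intro h
        obtain ⟨i, hi⟩ := hp ⟨h, by
          obtain ⟨i, j, rfl⟩ := hform h
          rw [MonoidHom.mem_ker, map_mul, hpker, map_zpow, ht1]; simp⟩
        have := congrArg Subtype.val hi
        exact ⟨Multiplicative.ofAdd i, by simpa using this⟩
    · right; right
      have huniq : ∀ i j : ℤ, p.1 ^ i * t ^ j = 1 → i = 0 ∧ j = 0 := by
        intro i j h
        have hj : j = 0 := by
          apply tinf ht1
          have := congrArg π h
          rwa [map_mul, hpker, one_mul, map_zpow, map_one] at this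
        subst hj
        exact ⟨pinf hp1 i (by simpa using h), rfl⟩
      have hker : ∀ (h : H), h * p.1 * h⁻¹ ∈ π.ker := fun h =>
        (MonoidHom.normal_ker π).conj_mem _ p.2 h
      obtain ⟨e, he⟩ := hp ⟨_, hker t⟩
      have he' : p.1 ^ e = t * p.1 * t⁻¹ := by simpa using congrArg Subtype.val he
      obtain ⟨e2, he2⟩ := hp ⟨_, hker t⁻¹⟩
      have he2' : p.1 ^ e2 = t⁻¹ * p.1 * t := by simpa using congrArg Subtype.val he2
      have hee : e * e2 = 1 := by
        have h1 : p.1 ^ (e * e2) = p.1 := by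
          rw [zpow_mul, he', conj_zpow, he2']; group
        have h2 : p.1 ^ (e * e2 - 1) = 1 := by rw [zpow_sub, h1]; simp
        have := pinf hp1 _ h2
        omega
      rcases Int.eq_one_or_neg_one_of_mul_eq_one hee with rfl | rfl
      · left
        have hc : Commute p.1 t := by
          rw [zpow_one, eq_mul_inv_iff_mul_eq] at he'
          exact he'
        let f : Multiplicative (ℤ × ℤ) →* H :=
          { toFun := fun x => p.1 ^ x.toAdd.1 * t ^ x.toAdd.2
            map_one' := by simp
            map_mul' := fun x y => by
              simp only [toAdd_mul, Prod.fst_add, Prod.snd_add, zpow_add]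
              have := (hc.zpow_zpow y.toAdd.1 x.toAdd.2).eq
              rw [mul_assoc, ← mul_assoc (p.1 ^ y.toAdd.1), this]
              simp only [mul_assoc] }
        refine ⟨(MulEquiv.ofBijective f ⟨?_, ?_⟩).symm⟩
        · rw [injective_iff_map_eq_one]
          intro x hx
          obtain ⟨h1, h2⟩ := huniq _ _ hx
          exact Prod.ext h1 h2
        · intro h
          obtain ⟨i, j, rfl⟩ := hform h
          exact ⟨Multiplicative.ofAdd (i, j), rfl⟩
      · right
        have hr : ∀ r ∈ kleinBottleRels, FreeGroup.lift ![p.1, t] r = 1 := by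
          rintro r rfl
          simp [← he']
        let f : KleinBottleGroup →* H := PresentedGroup.toGroup hr
        have hf : ∀ i j : ℤ, f (PresentedGroup.of 0 ^ i * PresentedGroup.of 1 ^ j) = p.1 ^ i * t ^ j := by
          intro i j
          simp [f]
        refine ⟨(MulEquiv.ofBijective f ⟨?_, ?_⟩).symm⟩
        · rw [injective_iff_map_eq_one]
          intro x hx
          obtain ⟨i, j, rfl⟩ := klein_normal_form x
          rw [hf] at hx
          obtain ⟨rfl, rfl⟩ := huniq _ _ hx
          simp
        · intro h
          obtain ⟨i, j, rfl⟩ := hform h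
          exact ⟨_, hf i j⟩

lemma main_aux {H : Type*} [Group H] (π : H →* Multiplicative ℤ) [IsFreeGroup π.ker]
    (hfg : ∃ S : Finset H, Subgroup.closure (S : Set H) = ⊤) :
    (3 : ℝ) ^ ((1 : ℝ) / 6) ≤ growthOmega H ∨ 
    Subsingleton H ∨ Nonempty (H ≃* Multiplicative ℤ) ∨
    Nonempty (H ≃* Multiplicative (ℤ × ℤ)) ∨ Nonempty (H ≃* KleinBottleGroup) := by
  by_cases h : ∀ S : Finset H, Subgroup.closure (S : Set H) = ⊤ →
      (3 : ℝ) ^ ((1 : ℝ) / 6) ≤ growthRate S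
  · left
    obtain ⟨S, hS⟩ := hfg
    refine le_csInf ⟨_, S, hS, rfl⟩ ?_
    rintro r ⟨T, hT, rfl⟩
    exact h T hT
  · right
    push Not at h
    obtain ⟨S, hS, hg⟩ := h
    exact classify π (kernel_comm π S hS hg)

end FreeAux

/-- Let `F` be a free group (of any rank) and `G = F ⋊_α ℤ`. Then every
finitely generated subgroup `H` of `G` satisfies `ω(H) ≥ 3^(1/6)`, unless `H` is
trivial, `ℤ`, `ℤ × ℤ`, or the Klein bottle group. -/
theorem statement10 {F : Type*} [Group F] (hF : IsFreeGroup F) (α : MulAut F)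
    (H : Subgroup (zSemidirect F α)) (hH : H.FG) :
    (3 : ℝ) ^ ((1 : ℝ) / 6) ≤ growthOmega ↥H ∨
    Subsingleton ↥H ∨ Nonempty (↥H ≃* Multiplicative ℤ) ∨
    Nonempty (↥H ≃* Multiplicative (ℤ × ℤ)) ∨ Nonempty (↥H ≃* KleinBottleGroup) := by
  let π : ↥H →* Multiplicative ℤ := SemidirectProduct.rightHom.comp H.subtype
  let f : π.ker →* F :=
    { toFun := fun h => h.1.1.left
      map_one' := by simp
      map_mul' := fun a b => by
        have ha : a.1.1.right = 1 := a.2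
        simp [ha] }
  have hf : Function.Injective f := by
    intro a b h
    have ha : a.1.1.right = 1 := a.2
    have hb : b.1.1.right = 1 := b.2
    apply Subtype.ext
    apply Subtype.ext
    exact SemidirectProduct.ext h (ha.trans hb.symm)
  have hfree : IsFreeGroup π.ker := IsFreeGroup.ofMulEquiv (MonoidHom.ofInjective hf).symm
  have hfg : ∃ S : Finset ↥H, Subgroup.closure (S : Set ↥H) = ⊤ :=
    ((Group.fg_iff_subgroup_fg H).2 hH).out
  exact FreeAux.main_aux π hfg
end

section
/- Let n be an integer with n ≠ 0, 1, −1 and let B = BS(1,n) be the Baumslag–Solitar group with presentation ⟨a, t | t a t⁻¹ = aⁿ⟩. Let G = B ⋊_α ℤ for any automorphism α of B. Then every finitely generated subgroup S of G satisfies ω(S) ≥ 2^{1/24}, unless S is isomorphic to the trivial group, ℤ, ℤ × ℤ, or the Klein bottle group. -/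
open Filter

/-- The single relator `t aᵐ t⁻¹ a⁻ⁿ` of the Baumslag–Solitar group
`BS(m,n) = ⟨a, t | t aᵐ t⁻¹ = aⁿ⟩`, with generator `0` as `a` and `1` as `t`. -/
def bsRels (m n : ℤ) : Set (FreeGroup (Fin 2)) :=
  {FreeGroup.of 1 * (FreeGroup.of 0) ^ m * (FreeGroup.of 1)⁻¹ * ((FreeGroup.of 0) ^ n)⁻¹}

/-- The Baumslag–Solitar group `BS(m,n) = ⟨a, t | t aᵐ t⁻¹ = aⁿ⟩`. -/
abbrev BaumslagSolitar (m n : ℤ) : Type := PresentedGroup (bsRels m n)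


section Growth

variable {H : Type*} [Group H]

open scoped Pointwise in
lemma wordBall_subset_pow [DecidableEq H] (T : Finset H) (n : ℕ) :
    wordBall T n ⊆ ((insert 1 (T ∪ T⁻¹) : Finset H) ^ n : Finset H) := by
  rintro g ⟨l, hl, hT, rfl⟩
  have key : ∀ l : List H, (∀ x ∈ l, x ∈ T ∨ x⁻¹ ∈ T) →
      l.prod ∈ ((insert 1 (T ∪ T⁻¹) : Finset H) ^ l.length : Finset H) := by
    intro l
    induction l with
    | nil => intro _; simp
    | cons x l ih =>
      intro h
      rw [List.prod_cons, List.length_cons, pow_succ']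
      refine Finset.mul_mem_mul ?_ (ih fun y hy => h y (List.mem_cons_of_mem _ hy))
      have := h x List.mem_cons_self
      simp only [Finset.mem_insert, Finset.mem_union, Finset.mem_inv']
      exact Or.inr this
  have h1 := key l hT
  exact_mod_cast Finset.pow_subset_pow_right (Finset.mem_insert_self _ _) hl h1

lemma wordBall_bound (T : Finset H) : ∃ K : ℕ, 1 ≤ K ∧ ∀ n,
    (wordBall T n).Finite ∧ (wordBall T n).ncard ≤ K ^ n := by
  classical
  open scoped Pointwise in
  refine ⟨(insert 1 (T ∪ T⁻¹) : Finset H).card, ?_, fun n => ?_⟩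
  · exact Finset.card_pos.mpr ⟨1, Finset.mem_insert_self _ _⟩
  · have h := wordBall_subset_pow T n
    refine ⟨(Finset.finite_toSet _).subset h, ?_⟩
    calc _ ≤ _ := Set.ncard_le_ncard h (Finset.finite_toSet _)
      _ ≤ _ := by
        rw [Set.ncard_coe_finset]
        exact Finset.card_pow_le

/-- A free-semigroup style lower bound for the growth rate. -/
lemma growthRate_ge (T : Finset H)
    (h : ∀ m : ℕ, 2 ^ m ≤ (wordBall T (3 * m)).ncard) :
    (2 : ℝ) ^ ((1 : ℝ) / 24) ≤ growthRate T := by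
  obtain ⟨K, hK1, hK⟩ := wordBall_bound T
  unfold growthRate
  refine Filter.le_limsup_of_frequently_le ?_ ?_
  · rw [Filter.frequently_atTop]
    intro N
    refine ⟨3 * (N + 1), by omega, ?_⟩
    have h1 : ((2 : ℝ) ^ (N + 1)) ≤ ((wordBall T (3 * (N + 1))).ncard : ℝ) := by
      exact_mod_cast h (N + 1)
    calc (2 : ℝ) ^ ((1 : ℝ) / 24) ≤ (2 : ℝ) ^ ((1 : ℝ) / 3) :=
          Real.rpow_le_rpow_of_exponent_le (by norm_num) (by norm_num)
      _ = ((2 : ℝ) ^ (N + 1)) ^ (1 / ((3 * (N + 1) : ℕ) : ℝ)) := by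
          rw [← Real.rpow_natCast, ← Real.rpow_mul (by norm_num)]
          congr 1
          have : ((N : ℝ) + 1) ≠ 0 := by positivity
          push_cast
          field_simp
      _ ≤ _ := Real.rpow_le_rpow (by positivity) h1 (by positivity)
  · refine Filter.isBoundedUnder_of ⟨(K : ℝ), fun n => ?_⟩
    rcases Nat.eq_zero_or_pos n with rfl | hn
    · simpa using hK1
    · have h1 : ((wordBall T n).ncard : ℝ) ≤ (K : ℝ) ^ n := by exact_mod_cast (hK n).2
      calc _ ≤ ((K : ℝ) ^ n) ^ (1 / (n : ℝ)) :=
            Real.rpow_le_rpow (by positivity) h1 (by positivity)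
        _ = K := by
            rw [← Real.rpow_natCast, ← Real.rpow_mul (by positivity)]
            rw [mul_one_div_cancel (by positivity), Real.rpow_one]

end Growth

/-- Abelian-by-`ℤ²` data: `ker τ ∩ ker ρ` embeds in `ℚ` via `φ`, with `H` acting through `χ`. -/
structure AffData (H : Type*) [Group H] where
  τ : H →* Multiplicative ℤ
  ρ : H →* Multiplicative ℤ
  φ : H → ℚ
  χ : H →* ℚ
  add_law : ∀ x y, τ x = 1 → ρ x = 1 → τ y = 1 → ρ y = 1 → φ (x * y) = φ x + φ y
  inj : ∀ x, τ x = 1 → ρ x = 1 → φ x = 0 → x = 1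
  conj : ∀ g x, τ x = 1 → ρ x = 1 → φ (g * x * g⁻¹) = χ g * φ x
  rank : ∀ g, ρ g = 1 → |χ g| = 1 → τ g = 1

namespace AffData

variable {H : Type*} [Group H] (d : AffData H)

/-- Restriction to a subgroup. -/
def restrict (S : Subgroup H) : AffData S where
  τ := d.τ.comp S.subtype
  ρ := d.ρ.comp S.subtype
  φ := fun s => d.φ s
  χ := d.χ.comp S.subtype
  add_law := fun x y h1 h2 h3 h4 => d.add_law x y h1 h2 h3 h4
  inj := fun x h1 h2 h3 => Subtype.ext (d.inj x h1 h2 h3)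
  conj := fun g x h1 h2 => d.conj g x h1 h2
  rank := fun g h1 h2 => d.rank g h1 h2

/-- The normal abelian subgroup. -/
def A : Subgroup H := d.τ.ker ⊓ d.ρ.ker

lemma mem_A {x : H} : x ∈ d.A ↔ d.τ x = 1 ∧ d.ρ x = 1 := by
  simp [A, Subgroup.mem_inf, MonoidHom.mem_ker]

/-- `φ` as a homomorphism on the normal abelian subgroup. -/
def φA : d.A →* Multiplicative ℚ where
  toFun x := Multiplicative.ofAdd (d.φ x)
  map_one' := by
    have h := d.add_law 1 1 (map_one _) (map_one _) (map_one _) (map_one _)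
    rw [mul_one] at h
    have : d.φ 1 = 0 := by linarith
    simp [this]
  map_mul' x y := by
    have hx := d.mem_A.1 x.2
    have hy := d.mem_A.1 y.2
    have := d.add_law x y hx.1 hx.2 hy.1 hy.2
    simp [this]

lemma φ_one : d.φ 1 = 0 := Multiplicative.ofAdd.injective (map_one d.φA)

lemma φ_mul {x y : H} (hx : x ∈ d.A) (hy : y ∈ d.A) : d.φ (x * y) = d.φ x + d.φ y :=
  d.add_law x y (d.mem_A.1 hx).1 (d.mem_A.1 hx).2 (d.mem_A.1 hy).1 (d.mem_A.1 hy).2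

lemma φ_inv {x : H} (hx : x ∈ d.A) : d.φ x⁻¹ = - d.φ x :=
  Multiplicative.ofAdd.injective (map_inv d.φA ⟨x, hx⟩)

lemma φ_zpow {x : H} (hx : x ∈ d.A) (k : ℤ) : d.φ (x ^ k) = k * d.φ x := by
  have := map_zpow d.φA ⟨x, hx⟩ k
  have h2 := congrArg Multiplicative.toAdd this
  rw [toAdd_zpow, zsmul_eq_mul] at h2
  exact h2

lemma φ_conj (g : H) {x : H} (hx : x ∈ d.A) : d.φ (g * x * g⁻¹) = d.χ g * d.φ x :=
  d.conj g x (d.mem_A.1 hx).1 (d.mem_A.1 hx).2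

lemma φ_eq_zero {x : H} (hx : x ∈ d.A) (h : d.φ x = 0) : x = 1 :=
  d.inj x (d.mem_A.1 hx).1 (d.mem_A.1 hx).2 h

lemma φ_inj {x y : H} (hx : x ∈ d.A) (hy : y ∈ d.A) (h : d.φ x = d.φ y) : x = y := by
  have : x * y⁻¹ = 1 := d.φ_eq_zero (d.A.mul_mem hx (d.A.inv_mem hy)) (by
    rw [d.φ_mul hx (d.A.inv_mem hy), d.φ_inv hy, h]; ring)
  exact mul_inv_eq_one.1 this

lemma conj_mem (g : H) {x : H} (hx : x ∈ d.A) : g * x * g⁻¹ ∈ d.A := by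
  rw [mem_A] at hx ⊢
  simp [hx.1, hx.2]

lemma comm_mem (g h : H) : g * h * g⁻¹ * h⁻¹ ∈ d.A := by
  rw [mem_A]
  constructor
  · rw [map_mul, map_mul, map_mul, map_inv, map_inv, mul_comm (d.τ g) (d.τ h)]; simp
  · rw [map_mul, map_mul, map_mul, map_inv, map_inv, mul_comm (d.ρ g) (d.ρ h)]; simp

/-- The words in `x` and `c * x`. -/
def W (x c : H) : List Bool → H
  | [] => 1
  | b :: w => (if b then c * x else x) * W x c w

lemma W_form (x c : H) (hc : c ∈ d.A) (p : ℕ) [Fact p.Prime]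
    (hp : padicNorm p (d.χ x) ≤ 1) (w : List Bool) :
    ∃ e ∈ d.A, ∃ z : ℚ, W x c w = e * x ^ w.length ∧ d.φ e = z * d.φ c ∧ padicNorm p z ≤ 1 := by
  induction w with
  | nil => exact ⟨1, d.A.one_mem, 0, by simp [W], by simp [φ_one], by simp⟩
  | cons b w ih =>
    obtain ⟨e, he, z, h1, h2, h3⟩ := ih
    have hxe := d.conj_mem x he
    have hq : padicNorm p (d.χ x * z) ≤ 1 := by
      rw [padicNorm.mul]; exact mul_le_one₀ hp (padicNorm.nonneg _) h3
    cases b with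
    | false =>
      refine ⟨x * e * x⁻¹, hxe, d.χ x * z, ?_, ?_, hq⟩
      · simp [W, h1, pow_succ', mul_assoc]
      · rw [d.φ_conj x he, h2]; ring
    | true =>
      refine ⟨c * (x * e * x⁻¹), d.A.mul_mem hc hxe, 1 + d.χ x * z, ?_, ?_, ?_⟩
      · simp [W, h1, pow_succ', mul_assoc]
      · rw [d.φ_mul hc hxe, d.φ_conj x he, h2]; ring
      · exact padicNorm.nonarchimedean.trans (max_le (by simp) hq)

lemma W_key (x c : H) (hc : c ∈ d.A) (hc1 : c ≠ 1) (p : ℕ) [Fact p.Prime]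
    (hp : padicNorm p (d.χ x) < 1) (u v : List Bool) (hl : u.length = v.length) :
    (c * x) * W x c u ≠ x * W x c v := by
  intro h
  obtain ⟨e, he, z, h1, h2, h3⟩ := d.W_form x c hc p hp.le u
  obtain ⟨f, hf, y, g1, g2, g3⟩ := d.W_form x c hc p hp.le v
  rw [h1, g1, hl] at h
  have h' : c * (x * e * x⁻¹) = x * f * x⁻¹ := by
    rw [← mul_assoc, ← mul_assoc] at h
    have := mul_right_cancel h
    rw [← this]; group
  have := congrArg d.φ h'
  rw [d.φ_mul hc (d.conj_mem x he), d.φ_conj x he, d.φ_conj x hf, h2, g2] at this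
  have hφc : d.φ c ≠ 0 := fun h0 => hc1 (d.φ_eq_zero hc h0)
  have h5 : (1 : ℚ) = d.χ x * (y - z) := by
    apply mul_right_cancel₀ hφc; linarith
  have h6 : padicNorm p (y - z) ≤ 1 := padicNorm.sub.trans (max_le g3 h3)
  have h7 : padicNorm p 1 < 1 := by
    have h8 := congrArg (padicNorm p) h5
    rw [h8, padicNorm.mul]
    exact mul_lt_one_of_nonneg_of_lt_one_left (padicNorm.nonneg _) hp h6
  simp at h7

lemma W_inj (x c : H) (hc : c ∈ d.A) (hc1 : c ≠ 1) (p : ℕ) [Fact p.Prime]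
    (hp : padicNorm p (d.χ x) < 1) (u v : List Bool) (hl : u.length = v.length)
    (h : W x c u = W x c v) : u = v := by
  induction u generalizing v with
  | nil => exact (List.length_eq_zero_iff.1 hl.symm).symm
  | cons b u ih =>
    cases v with
    | nil => simp at hl
    | cons b' v =>
      have hl' : u.length = v.length := by simpa using hl
      cases b <;> cases b' <;> simp only [W, if_true, Bool.false_eq_true, if_false] at h
      · rw [ih v hl' (mul_left_cancel h)]
      · exact absurd h.symm (d.W_key x c hc hc1 p hp v u hl'.symm)
      · exact absurd h (d.W_key x c hc hc1 p hp u v hl')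
      · rw [ih v hl' (mul_left_cancel h)]

lemma W_mem (T : Finset H) (x y c : H) (hx : x ∈ T ∨ x⁻¹ ∈ T) (hy : y ∈ T ∨ y⁻¹ ∈ T)
    (hc : c * x = y * x * y⁻¹) (w : List Bool) : W x c w ∈ wordBall T (3 * w.length) := by
  induction w with
  | nil => exact ⟨[], by simp, by simp, by simp [W]⟩
  | cons b w ih =>
    obtain ⟨l, h1, h2, h3⟩ := ih
    cases b with
    | false =>
      refine ⟨x :: l, ?_, ?_, ?_⟩
      · simp; omega
      · intro z hz
        rcases List.mem_cons.1 hz with rfl | hz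
        · exact hx
        · exact h2 z hz
      · simp [W, h3]
    | true =>
      refine ⟨y :: x :: y⁻¹ :: l, ?_, ?_, ?_⟩
      · simp; omega
      · intro z hz
        simp only [List.mem_cons] at hz
        rcases hz with rfl | rfl | rfl | hz
        · exact hy
        · exact hx
        · rw [inv_inv]; exact hy.symm
        · exact h2 z hz
      · simp [W, h3, hc, mul_assoc]

lemma growth_of_padic (T : Finset H) (x y : H) (hx : x ∈ T ∨ x⁻¹ ∈ T) (hy : y ∈ T ∨ y⁻¹ ∈ T)
    (hxy : y * x * y⁻¹ * x⁻¹ ≠ 1) (p : ℕ) [Fact p.Prime] (hp : padicNorm p (d.χ x) < 1) :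
    (2 : ℝ) ^ ((1 : ℝ) / 24) ≤ growthRate T := by
  apply growthRate_ge
  intro m
  obtain ⟨K, _, hK⟩ := wordBall_bound T
  have hcard : 2 ^ m = (Set.univ : Set (List.Vector Bool m)).ncard := by
    rw [Set.ncard_univ, Nat.card_eq_fintype_card, card_vector, Fintype.card_bool]
  rw [hcard]
  refine Set.ncard_le_ncard_of_injOn (fun w => W x (y * x * y⁻¹ * x⁻¹) w.1) ?_ ?_ (hK _).1
  · intro w _
    have := W_mem T x y (y * x * y⁻¹ * x⁻¹) hx hy (by group) w.1
    rwa [w.2] at this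
  · intro u _ v _ h
    exact Subtype.ext (d.W_inj x _ (d.comm_mem y x) hxy p hp u.1 v.1 (u.2.trans v.2.symm) h)

lemma exists_prime_padic (q : ℚ) (h1 : |q| ≠ 1) :
    ∃ p : ℕ, ∃ _ : Fact p.Prime, padicNorm p q < 1 ∨ padicNorm p q⁻¹ < 1 := by
  by_cases hn : q.num.natAbs = 1
  · have hd : q.den ≠ 1 := by
      intro hd
      apply h1
      rw [← Rat.num_div_den q, hd]
      rcases Int.natAbs_eq q.num with h | h <;> rw [h, hn] <;> simp
    obtain ⟨p, hp, hpd⟩ := Nat.exists_prime_and_dvd hd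
    have : Fact p.Prime := ⟨hp⟩
    refine ⟨p, ⟨hp⟩, Or.inr ?_⟩
    have hnum : padicNorm p (q.num : ℚ) = 1 := by
      rcases Int.natAbs_eq q.num with h | h <;> rw [h, hn] <;> simp
    have : q⁻¹ = q.den / q.num := by
      conv_lhs => rw [← Rat.num_div_den q]
      rw [inv_div]
    rw [this, padicNorm.div, hnum, div_one]
    exact (padicNorm.nat_lt_one_iff _).2 hpd
  · obtain ⟨p, hp, hpd⟩ := Nat.exists_prime_and_dvd hn
    have : Fact p.Prime := ⟨hp⟩
    refine ⟨p, ⟨hp⟩, Or.inl ?_⟩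
    have hden : padicNorm p (q.den : ℚ) = 1 := by
      rw [padicNorm.nat_eq_one_iff]
      intro h
      have := Nat.dvd_gcd hpd h
      rw [q.reduced] at this
      exact hp.one_lt.ne' (Nat.dvd_one.1 this)
    rw [← Rat.num_div_den q, padicNorm.div, hden, div_one]
    exact (padicNorm.int_lt_one_iff (p := p) _).2 (Int.natCast_dvd.2 hpd)

lemma χ_ne_zero (g : H) : d.χ g ≠ 0 := by
  intro h
  have := map_mul d.χ g g⁻¹
  simp [h] at this

lemma χ_inv (g : H) : d.χ g⁻¹ = (d.χ g)⁻¹ := by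
  have := map_mul d.χ g g⁻¹
  rw [mul_inv_cancel, map_one] at this
  exact eq_inv_of_mul_eq_one_right this.symm

/-- The exponential growth case. -/
lemma growth_case (s : H) (hs : |d.χ s| ≠ 1) (a : H) (ha : a ∈ d.A) (ha1 : a ≠ 1)
    (T : Finset H) (hT : Subgroup.closure (T : Set H) = ⊤) :
    (2 : ℝ) ^ ((1 : ℝ) / 24) ≤ growthRate T := by
  obtain ⟨x, hxT, hx⟩ : ∃ x ∈ T, |d.χ x| ≠ 1 := by
    by_contra! hcon
    apply hs
    have : s ∈ Subgroup.closure (T : Set H) := hT ▸ Subgroup.mem_top s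
    induction this using Subgroup.closure_induction with
    | mem x hx => exact hcon x hx
    | one => simp
    | mul x y _ _ hx hy =>
      have hx' : |d.χ x| = 1 := by by_contra h; simp_all
      have hy' : |d.χ y| = 1 := by by_contra h; simp_all
      rw [map_mul, abs_mul, hx', hy', one_mul]
    | inv x _ hx =>
      have hx' : |d.χ x| = 1 := by by_contra h; simp_all
      rw [χ_inv, abs_inv, hx', inv_one]
  obtain ⟨y, hyT, hy⟩ : ∃ y ∈ T, y * x ≠ x * y := by
    by_contra! hcon
    have hle : Subgroup.closure (T : Set H) ≤ Subgroup.centralizer {x} := by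
      rw [Subgroup.closure_le]
      intro y hy
      rw [SetLike.mem_coe, Subgroup.mem_centralizer_iff]
      rintro _ rfl
      exact (hcon y hy).symm
    rw [hT] at hle
    have hax := Subgroup.mem_centralizer_iff.1 (hle (Subgroup.mem_top a)) x rfl
    have h1 := d.φ_conj x ha
    rw [hax, mul_inv_cancel_right] at h1
    have h2 : d.φ a ≠ 0 := fun h => ha1 (d.φ_eq_zero ha h)
    have h3 : d.χ x = 1 := by
      apply mul_right_cancel₀ h2; rw [← h1, one_mul]
    exact hx (by rw [h3, abs_one])
  obtain ⟨p, hp, h | h⟩ := exists_prime_padic (d.χ x) hx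
  · refine d.growth_of_padic T x y (Or.inl hxT) (Or.inl hyT) ?_ p h
    intro h
    apply hy
    rw [mul_inv_eq_one, mul_inv_eq_iff_eq_mul] at h
    exact h
  · rw [← χ_inv] at h
    refine d.growth_of_padic T x⁻¹ y (Or.inr (by simpa using hxT)) (Or.inl hyT) ?_ p h
    intro h
    apply hy
    rw [mul_inv_eq_one, mul_inv_eq_iff_eq_mul, eq_inv_mul_iff_mul_eq, ← mul_assoc,
      mul_inv_eq_iff_eq_mul] at h
    exact h.symm

lemma omega_case (hfg : Group.FG H) (s : H) (hs : |d.χ s| ≠ 1) (a : H) (ha : a ∈ d.A)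
    (ha1 : a ≠ 1) : (2 : ℝ) ^ ((1 : ℝ) / 24) ≤ growthOmega H := by
  refine le_csInf ?_ ?_
  · obtain ⟨T, hT⟩ := (Group.fg_def.1 hfg : (⊤ : Subgroup H).FG)
    exact ⟨_, T, hT, rfl⟩
  · rintro r ⟨T, hT, rfl⟩
    exact d.growth_case s hs a ha ha1 T hT

end AffData

namespace AffData

variable {H : Type*} [Group H] (d : AffData H)

/-- A subgroup-like group embedding in `ℤ²` is trivial, `ℤ` or `ℤ²`. -/
lemma classify_abelian (f : H →* Multiplicative (ℤ × ℤ)) (hf : Function.Injective f) :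
    Subsingleton H ∨ Nonempty (H ≃* Multiplicative ℤ) ∨
      Nonempty (H ≃* Multiplicative (ℤ × ℤ)) := by
  let N : Submodule ℤ (ℤ × ℤ) := AddSubgroup.toIntSubmodule (Subgroup.toAddSubgroup' f.range)
  have e : H ≃* Multiplicative N :=
    (MonoidHom.ofInjective hf).trans
      { toFun := fun x => Multiplicative.ofAdd ⟨Multiplicative.toAdd x.1, x.2⟩
        invFun := fun x => ⟨Multiplicative.ofAdd (Multiplicative.toAdd x).1,
          (Multiplicative.toAdd x).2⟩
        left_inv := fun x => rfl
        right_inv := fun x => rfl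
        map_mul' := fun x y => rfl }
  have hr : Module.finrank ℤ N ≤ 2 := by
    have h := Submodule.finrank_le N
    simpa using h
  have b := Module.finBasis ℤ N
  generalize Module.finrank ℤ N = r at hr b
  have e2 : Multiplicative N ≃* Multiplicative (Fin r → ℤ) :=
    AddEquiv.toMultiplicative b.equivFun.toAddEquiv
  interval_cases r
  · left
    exact (e.trans e2).toEquiv.subsingleton
  · right; left
    exact ⟨(e.trans e2).trans
      (AddEquiv.toMultiplicative (LinearEquiv.funUnique (Fin 1) ℤ ℤ).toAddEquiv)⟩
  · right; right
    exact ⟨(e.trans e2).trans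
      (AddEquiv.toMultiplicative (LinearEquiv.finTwoArrow ℤ ℤ).toAddEquiv)⟩

lemma case_trivial (h : ∀ a ∈ d.A, a = 1) :
    Subsingleton H ∨ Nonempty (H ≃* Multiplicative ℤ) ∨
      Nonempty (H ≃* Multiplicative (ℤ × ℤ)) := by
  let f : H →* Multiplicative (ℤ × ℤ) :=
    { toFun := fun x => Multiplicative.ofAdd
        (Multiplicative.toAdd (d.τ x), Multiplicative.toAdd (d.ρ x))
      map_one' := by simp
      map_mul' := fun x y => by simp [← ofAdd_add] }
  apply classify_abelian f
  rw [injective_iff_map_eq_one]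
  intro a ha
  apply h
  rw [mem_A]
  have h2 : (Multiplicative.toAdd (d.τ a), Multiplicative.toAdd (d.ρ a)) = ((0 : ℤ), (0 : ℤ)) :=
    Multiplicative.ofAdd.injective ha
  exact ⟨Multiplicative.toAdd.injective (congrArg Prod.fst h2),
    Multiplicative.toAdd.injective (congrArg Prod.snd h2)⟩

lemma mem_A_of_ρ (hχ : ∀ s, |d.χ s| = 1) {g : H} (hg : d.ρ g = 1) : g ∈ d.A :=
  d.mem_A.2 ⟨d.rank g hg (hχ g), hg⟩

/-- Some element `s₀`, trivial or of nontrivial `ρ`-image, generates the image of `ρ`. -/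
lemma exists_s0 : ∃ s₀ : H, (s₀ = 1 ∨ d.ρ s₀ ≠ 1) ∧ ∀ g, ∃ k : ℤ, d.ρ g = d.ρ s₀ ^ k := by
  obtain ⟨⟨_, s, rfl⟩, hr⟩ := IsCyclic.exists_generator (α := d.ρ.range)
  have hr' : ∀ g, ∃ k : ℤ, d.ρ g = d.ρ s ^ k := by
    intro g
    obtain ⟨k, hk⟩ := hr ⟨d.ρ g, g, rfl⟩
    exact ⟨k, (congrArg Subtype.val hk).symm⟩
  by_cases h : d.ρ s = 1
  · refine ⟨1, Or.inl rfl, fun g => ⟨0, ?_⟩⟩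
    obtain ⟨k, hk⟩ := hr' g
    rw [hk, h]; simp
  · exact ⟨s, Or.inr h, hr'⟩

lemma χ_pm (hχ : ∀ s, |d.χ s| = 1) (s : H) : d.χ s = 1 ∨ d.χ s = -1 :=
  (abs_eq zero_le_one).1 (hχ s)

lemma exists_den (hfg : Group.FG H) (hχ : ∀ s, |d.χ s| = 1) (s₀ : H)
    (hs0 : s₀ = 1 ∨ d.ρ s₀ ≠ 1) (hs : ∀ g, ∃ k : ℤ, d.ρ g = d.ρ s₀ ^ k) :
    ∃ D : ℤ, D ≠ 0 ∧ ∀ a ∈ d.A, ∃ m : ℤ, D * d.φ a = m := by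
  obtain ⟨T, hT⟩ := (Group.fg_def.1 hfg : (⊤ : Subgroup H).FG)
  choose k hk using hs
  let r : H → H := fun g => s₀ ^ (-k g) * g
  have hr : ∀ g, r g ∈ d.A := fun g => d.mem_A_of_ρ hχ (by
    simp only [r, map_mul, map_zpow, hk g]; group)
  refine ⟨((∏ x ∈ T, (d.φ (r x)).den : ℕ) : ℤ), ?_, ?_⟩
  · exact_mod_cast Finset.prod_ne_zero_iff.2 fun x _ => (d.φ (r x)).den_nz
  set D : ℤ := ((∏ x ∈ T, (d.φ (r x)).den : ℕ) : ℤ) with hD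
  have key : ∀ g ∈ Subgroup.closure (T : Set H), ∃ j : ℤ, ∃ a ∈ d.A, g = s₀ ^ j * a ∧
      ∃ m : ℤ, D * d.φ a = m := by
    intro g hg
    induction hg using Subgroup.closure_induction with
    | mem x hx =>
      refine ⟨k x, r x, hr x, by simp [r], ?_⟩
      have hdvd : (d.φ (r x)).den ∣ ∏ x ∈ T, (d.φ (r x)).den :=
        Finset.dvd_prod_of_mem (fun x => (d.φ (r x)).den) hx
      obtain ⟨c, hc⟩ := hdvd
      refine ⟨c * (d.φ (r x)).num, ?_⟩
      rw [hD, hc]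
      push_cast
      rw [mul_comm ((d.φ (r x)).den : ℚ), mul_assoc, Rat.den_mul_eq_num]
    | one => exact ⟨0, 1, d.A.one_mem, by simp, 0, by simp [φ_one]⟩
    | mul x y _ _ hx hy =>
      obtain ⟨j, a, ha, hxa, m, hm⟩ := hx
      obtain ⟨j', a', ha', hya, m', hm'⟩ := hy
      have hca := d.conj_mem (s₀ ^ (-j')) ha
      refine ⟨j + j', s₀ ^ (-j') * a * (s₀ ^ (-j'))⁻¹ * a', d.A.mul_mem hca ha', ?_, ?_⟩
      · rw [hxa, hya]; group
      · rw [d.φ_mul hca ha', d.φ_conj _ ha]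
        rcases d.χ_pm hχ (s₀ ^ (-j')) with h | h
        · exact ⟨m + m', by rw [h]; push_cast; linarith⟩
        · exact ⟨-m + m', by rw [h]; push_cast; linarith⟩
    | inv x _ hx =>
      obtain ⟨j, a, ha, hxa, m, hm⟩ := hx
      have hca := d.conj_mem (s₀ ^ j) (d.A.inv_mem ha)
      refine ⟨-j, s₀ ^ j * a⁻¹ * (s₀ ^ j)⁻¹, hca, by rw [hxa]; group, ?_⟩
      rw [d.φ_conj _ (d.A.inv_mem ha), d.φ_inv ha]
      rcases d.χ_pm hχ (s₀ ^ j) with h | h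
      · exact ⟨-m, by rw [h]; push_cast; linarith⟩
      · exact ⟨m, by rw [h]; push_cast; linarith⟩
  intro g hg
  obtain ⟨j, a, ha, hga, hm⟩ := key g (hT ▸ Subgroup.mem_top g)
  rcases hs0 with rfl | hs0
  · rw [one_zpow, one_mul] at hga
    rwa [hga]
  · have h1 : d.ρ s₀ ^ j = 1 := by
      have := congrArg d.ρ hga
      rw [map_mul, (d.mem_A.1 hg).2, (d.mem_A.1 ha).2, mul_one, map_zpow] at this
      exact this.symm
    have h2 : j = 0 := by
      have h3 := congrArg Multiplicative.toAdd h1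
      rw [toAdd_zpow, toAdd_one, smul_eq_mul, mul_eq_zero] at h3
      exact h3.resolve_right fun h4 => hs0 (Multiplicative.toAdd.injective h4)
    rw [h2, zpow_zero, one_mul] at hga
    rwa [hga]

lemma exists_gen (D : ℤ) (hD : D ≠ 0) (h : ∀ a ∈ d.A, ∃ m : ℤ, D * d.φ a = m) :
    ∃ c ∈ d.A, ∀ a ∈ d.A, ∃ k : ℤ, a = c ^ k := by
  choose m hm using h
  have hDQ : (D : ℚ) ≠ 0 := by exact_mod_cast hD
  let f : d.A →* Multiplicative ℤ :=
    { toFun := fun a => Multiplicative.ofAdd (m a.1 a.2)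
      map_one' := by
        apply Multiplicative.toAdd.injective
        have := hm 1 d.A.one_mem
        rw [φ_one, mul_zero] at this
        exact_mod_cast this.symm
      map_mul' := fun x y => by
        apply Multiplicative.toAdd.injective
        have h1 := hm _ (x * y).2
        have h2 := hm _ x.2
        have h3 := hm _ y.2
        have h4 := d.φ_mul x.2 y.2
        have h5 : ((m _ (x * y).2 : ℤ) : ℚ) = (m _ x.2 : ℤ) + (m _ y.2 : ℤ) := by
          rw [← h1, ← h2, ← h3, ← mul_add, ← h4]; rfl
        exact_mod_cast h5 }
  have hf : Function.Injective f := by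
    intro x y hxy
    have h1 : m _ x.2 = m _ y.2 := Multiplicative.ofAdd.injective hxy
    apply Subtype.ext
    apply d.φ_inj x.2 y.2
    apply mul_left_cancel₀ hDQ
    rw [hm _ x.2, hm _ y.2, h1]
  have : IsCyclic d.A := isCyclic_of_injective f hf
  obtain ⟨c, hc⟩ := IsCyclic.exists_generator (α := d.A)
  refine ⟨c, c.2, fun a ha => ?_⟩
  obtain ⟨k, hk⟩ := hc ⟨a, ha⟩
  exact ⟨k, (congrArg Subtype.val hk).symm⟩

end AffData

/-- Normal form in the Klein bottle group. -/
lemma klein_normal_form (g : KleinBottleGroup) : ∃ m k : ℤ,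
    g = (PresentedGroup.of 0 : KleinBottleGroup) ^ m * (PresentedGroup.of 1) ^ k := by
  set a : KleinBottleGroup := PresentedGroup.of 0 with ha
  set t : KleinBottleGroup := PresentedGroup.of 1 with ht
  have hrel : t * a * t⁻¹ * a = 1 := PresentedGroup.one_of_mem (rels := kleinBottleRels) rfl
  have hrel1 : t * a * t⁻¹ = a⁻¹ := mul_eq_one_iff_eq_inv.1 hrel
  have h1 : ∀ m : ℤ, t * a ^ m = a ^ (-m) * t := by
    intro m
    have : (t * a * t⁻¹) ^ m = t * a ^ m * t⁻¹ := conj_zpow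
    rw [hrel1, inv_zpow, ← zpow_neg] at this
    rw [this]; group
  have h2 : ∀ m : ℤ, t⁻¹ * a ^ m = a ^ (-m) * t⁻¹ := by
    intro m
    have := h1 (-m)
    rw [neg_neg] at this
    rw [inv_mul_eq_iff_eq_mul, ← mul_assoc, this]; group
  have hmem : g ∈ Subgroup.closure (Set.range (PresentedGroup.of (rels := kleinBottleRels))) := by
    rw [PresentedGroup.closure_range_of]; trivial
  induction hmem using Subgroup.closure_induction_left with
  | one => exact ⟨0, 0, by simp⟩
  | mul_left x hx y _ ih =>
    obtain ⟨m, k, rfl⟩ := ih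
    obtain ⟨i, rfl⟩ := hx
    fin_cases i
    · exact ⟨1 + m, k, by simp [zpow_add, mul_assoc, ha]⟩
    · refine ⟨-m, 1 + k, ?_⟩
      change t * _ = _
      rw [← mul_assoc, h1, zpow_add, zpow_one, mul_assoc]
  | inv_mul_cancel x hx y _ ih =>
    obtain ⟨m, k, rfl⟩ := ih
    obtain ⟨i, rfl⟩ := hx
    fin_cases i
    · exact ⟨-1 + m, k, by simp [zpow_add, mul_assoc, ha]⟩
    · refine ⟨-m, -1 + k, ?_⟩
      change t⁻¹ * _ = _
      rw [← mul_assoc, h2, zpow_add, zpow_neg_one, mul_assoc]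

namespace AffData

variable {H : Type*} [Group H] (d : AffData H)

lemma zpow_c {c : H} (hc : c ∈ d.A) (hc1 : c ≠ 1) {k : ℤ} (h : c ^ k = 1) : k = 0 := by
  have h1 := d.φ_zpow hc k
  rw [h, φ_one] at h1
  have h2 : d.φ c ≠ 0 := fun h0 => hc1 (d.φ_eq_zero hc h0)
  have h3 := (mul_eq_zero.1 h1.symm).resolve_right h2
  exact_mod_cast h3

lemma case_polynomial (hfg : Group.FG H) (hχ : ∀ s, |d.χ s| = 1) (hA : ∃ a ∈ d.A, a ≠ 1) :
    Nonempty (H ≃* Multiplicative ℤ) ∨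
      Nonempty (H ≃* Multiplicative (ℤ × ℤ)) ∨ Nonempty (H ≃* KleinBottleGroup) := by
  obtain ⟨s, hs0, hs⟩ := d.exists_s0
  obtain ⟨D, hD, hDm⟩ := d.exists_den hfg hχ s hs0 hs
  obtain ⟨c, hc, hgen⟩ := d.exists_gen D hD hDm
  have hc1 : c ≠ 1 := by
    rintro rfl
    obtain ⟨a, ha, ha1⟩ := hA
    obtain ⟨k, hk⟩ := hgen a ha
    exact ha1 (by rw [hk, one_zpow])
  -- every element is `c ^ m * s ^ k`
  have hform : ∀ g, ∃ m k : ℤ, g = c ^ m * s ^ k := by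
    intro g
    obtain ⟨k, hk⟩ := hs g
    have : g * s ^ (-k) ∈ d.A := d.mem_A_of_ρ hχ (by
      rw [map_mul, map_zpow, hk]; group)
    obtain ⟨m, hm⟩ := hgen _ this
    exact ⟨m, k, by rw [← hm]; group⟩
  rcases hs0 with rfl | hs0
  · left
    refine ⟨(MulEquiv.ofBijective (zpowersHom H c) ⟨?_, ?_⟩).symm⟩
    · rw [injective_iff_map_eq_one]
      intro k hk
      rw [zpowersHom_apply] at hk
      exact Multiplicative.toAdd.injective (d.zpow_c hc hc1 hk)
    · intro g
      obtain ⟨m, k, hg⟩ := hform g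
      exact ⟨Multiplicative.ofAdd m, by simp [hg]⟩
  right
  have huniq : ∀ m k : ℤ, c ^ m * s ^ k = 1 → m = 0 ∧ k = 0 := by
    intro m k h
    have h1 : d.ρ s ^ k = 1 := by
      have := congrArg d.ρ h
      rwa [map_mul, map_zpow, (d.mem_A.1 hc).2, one_zpow, one_mul, map_zpow, map_one] at this
    have h2 : k = 0 := by
      have h3 := congrArg Multiplicative.toAdd h1
      rw [toAdd_zpow, toAdd_one, smul_eq_mul, mul_eq_zero] at h3
      exact h3.resolve_right fun h4 => hs0 (Multiplicative.toAdd.injective h4)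
    rw [h2, zpow_zero, mul_one] at h
    exact ⟨d.zpow_c hc hc1 h, h2⟩
  have hconj := d.φ_conj s hc
  rcases d.χ_pm hχ s with h | h
  · left
    have hcomm : s * c * s⁻¹ = c := d.φ_inj (d.conj_mem s hc) hc (by rw [hconj, h, one_mul])
    have hcomm' : Commute c s := by
      rw [mul_inv_eq_iff_eq_mul] at hcomm; exact hcomm.symm
    let f : Multiplicative (ℤ × ℤ) →* H :=
      { toFun := fun x => c ^ (Multiplicative.toAdd x).1 * s ^ (Multiplicative.toAdd x).2
        map_one' := by simp
        map_mul' := fun x y => by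
          simp only [toAdd_mul, Prod.fst_add, Prod.snd_add, zpow_add]
          have := (hcomm'.zpow_zpow (Multiplicative.toAdd y).1 (Multiplicative.toAdd x).2).eq
          rw [mul_assoc, ← mul_assoc _ (s ^ _) (s ^ _), this]
          simp only [mul_assoc] }
    refine ⟨(MulEquiv.ofBijective f ⟨?_, ?_⟩).symm⟩
    · rw [injective_iff_map_eq_one]
      intro x hx
      obtain ⟨h1, h2⟩ := huniq _ _ hx
      exact Multiplicative.toAdd.injective (Prod.ext h1 h2)
    · intro g
      obtain ⟨m, k, hg⟩ := hform g
      exact ⟨Multiplicative.ofAdd (m, k), hg.symm⟩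
  · right
    have hcomm : s * c * s⁻¹ = c⁻¹ := d.φ_inj (d.conj_mem s hc) (d.A.inv_mem hc) (by
      rw [hconj, h, d.φ_inv hc]; ring)
    let f : KleinBottleGroup →* H := PresentedGroup.toGroup (f := ![c, s]) (by
      rintro r rfl
      simp [hcomm])
    have hf0 : f (PresentedGroup.of 0) = c := by simp [f]
    have hf1 : f (PresentedGroup.of 1) = s := by simp [f]
    refine ⟨(MulEquiv.ofBijective f ⟨?_, ?_⟩).symm⟩
    · rw [injective_iff_map_eq_one]
      intro x hx
      obtain ⟨m, k, rfl⟩ := klein_normal_form x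
      rw [map_mul, map_zpow, map_zpow, hf0, hf1] at hx
      obtain ⟨h1, h2⟩ := huniq _ _ hx
      simp [h1, h2]
    · intro g
      obtain ⟨m, k, hg⟩ := hform g
      exact ⟨PresentedGroup.of 0 ^ m * PresentedGroup.of 1 ^ k, by
        rw [map_mul, map_zpow, map_zpow, hf0, hf1, hg]⟩

theorem main (d : AffData H) (hfg : Group.FG H) :
    (2 : ℝ) ^ ((1 : ℝ) / 24) ≤ growthOmega H ∨
    Subsingleton H ∨ Nonempty (H ≃* Multiplicative ℤ) ∨
    Nonempty (H ≃* Multiplicative (ℤ × ℤ)) ∨ Nonempty (H ≃* KleinBottleGroup) := by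
  by_cases hA : ∀ a ∈ d.A, a = 1
  · rcases d.case_trivial hA with h | h | h
    · exact Or.inr (Or.inl h)
    · exact Or.inr (Or.inr (Or.inl h))
    · exact Or.inr (Or.inr (Or.inr (Or.inl h)))
  push Not at hA
  by_cases hχ : ∀ s, |d.χ s| = 1
  · exact Or.inr (Or.inr (d.case_polynomial hfg hχ hA))
  · push Not at hχ
    obtain ⟨s, hs⟩ := hχ
    obtain ⟨a, ha, ha1⟩ := hA
    exact Or.inl (d.omega_case hfg s hs a ha ha1)

end AffData

/-- Build the data when the normal subgroup contains an element with `φ a₀ = 1`. -/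
def AffData.ofBase {G : Type*} [Group G] (τ ρ : G →* Multiplicative ℤ) (φ : G → ℚ)
    (hadd : ∀ x y, τ x = 1 → ρ x = 1 → τ y = 1 → ρ y = 1 → φ (x * y) = φ x + φ y)
    (hinj : ∀ x, τ x = 1 → ρ x = 1 → φ x = 0 → x = 1)
    (a₀ : G) (hτ : τ a₀ = 1) (hρ : ρ a₀ = 1) (hφ : φ a₀ = 1)
    (hrank : ∀ g, ρ g = 1 → |φ (g * a₀ * g⁻¹)| = 1 → τ g = 1) : AffData G :=
  have hone : φ 1 = 0 := by
    have h := hadd 1 1 (map_one _) (map_one _) (map_one _) (map_one _)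
    rw [mul_one] at h
    linarith
  have hinv : ∀ x, τ x = 1 → ρ x = 1 → φ x⁻¹ = - φ x := by
    intro x h1 h2
    have h := hadd x x⁻¹ h1 h2 (by simp [h1]) (by simp [h2])
    rw [mul_inv_cancel, hone] at h
    linarith
  have hpow : ∀ x, τ x = 1 → ρ x = 1 → ∀ m : ℕ, φ (x ^ m) = m * φ x := by
    intro x h1 h2 m
    induction m with
    | zero => simp [hone]
    | succ m ih =>
      rw [pow_succ, hadd _ _ (by simp [h1]) (by simp [h2]) h1 h2, ih]
      push_cast; ring
  have hzpow : ∀ x, τ x = 1 → ρ x = 1 → ∀ m : ℤ, φ (x ^ m) = m * φ x := by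
    intro x h1 h2 m
    obtain ⟨k, rfl | rfl⟩ := m.eq_nat_or_neg
    · rw [zpow_natCast, hpow x h1 h2]; simp
    · rw [zpow_neg, zpow_natCast, hinv _ (by simp [h1]) (by simp [h2]), hpow x h1 h2]; simp
  have hconj : ∀ g x, τ x = 1 → ρ x = 1 → φ (g * x * g⁻¹) = φ (g * a₀ * g⁻¹) * φ x := by
    intro g x h1 h2
    have e : x ^ (φ x).den = a₀ ^ (φ x).num := by
      have h3 : x ^ (φ x).den * (a₀ ^ (φ x).num)⁻¹ = 1 := by
        apply hinj
        · simp [h1, hτ]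
        · simp [h2, hρ]
        · rw [hadd _ _ (by simp [h1]) (by simp [h2]) (by simp [hτ]) (by simp [hρ]),
            hpow x h1 h2, hinv _ (by simp [hτ]) (by simp [hρ]), hzpow _ hτ hρ, hφ,
            Rat.den_mul_eq_num]
          ring
      exact mul_inv_eq_one.1 h3
    have e2 : (g * x * g⁻¹) ^ (φ x).den = (g * a₀ * g⁻¹) ^ (φ x).num := by
      rw [conj_pow, conj_zpow, e]
    have e3 := congrArg φ e2
    rw [hpow _ (by simp [h1]) (by simp [h2]), hzpow _ (by simp [hτ]) (by simp [hρ])] at e3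
    have hd : ((φ x).den : ℚ) ≠ 0 := by exact_mod_cast (φ x).den_nz
    apply mul_left_cancel₀ hd
    rw [e3, ← Rat.den_mul_eq_num (φ x)]
    ring
  { τ := τ
    ρ := ρ
    φ := φ
    χ :=
      { toFun := fun g => φ (g * a₀ * g⁻¹)
        map_one' := by simp [hφ]
        map_mul' := fun g h => by
          rw [← hconj g (h * a₀ * h⁻¹) (by simp [hτ]) (by simp [hρ])]
          congr 1
          group }
    add_law := hadd
    inj := hinj
    conj := hconj
    rank := hrank }

namespace BS

/-- The generator `a`. -/
def a (n : ℤ) : BaumslagSolitar 1 n := PresentedGroup.of 0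

/-- The generator `t`. -/
def t (n : ℤ) : BaumslagSolitar 1 n := PresentedGroup.of 1

lemma rel (n : ℤ) : t n * a n * (t n)⁻¹ = a n ^ n := by
  have h : t n * (a n) ^ (1 : ℤ) * (t n)⁻¹ * ((a n) ^ n)⁻¹ = 1 :=
    PresentedGroup.one_of_mem (rels := bsRels 1 n) rfl
  rw [zpow_one] at h
  exact mul_inv_eq_one.1 h

lemma t_mul (n k : ℤ) : t n * a n ^ k = a n ^ (n * k) * t n := by
  have h : (t n * a n * (t n)⁻¹) ^ k = t n * a n ^ k * (t n)⁻¹ := conj_zpow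
  rw [rel, ← zpow_mul] at h
  rw [h]; group

lemma tpow_mul (n k : ℤ) (i : ℕ) : t n ^ i * a n ^ k = a n ^ (n ^ i * k) * t n ^ i := by
  induction i with
  | zero => simp
  | succ i ih =>
    rw [pow_succ', mul_assoc, ih, ← mul_assoc, t_mul, mul_assoc, pow_succ', mul_assoc]

lemma normal_form (n : ℤ) (g : BaumslagSolitar 1 n) :
    ∃ (i j : ℕ) (k : ℤ), g = (t n ^ i)⁻¹ * a n ^ k * t n ^ j := by
  have ha : ∀ (e : ℤ) (i j : ℕ) (k : ℤ), a n ^ e * ((t n ^ i)⁻¹ * a n ^ k * t n ^ j) =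
      (t n ^ i)⁻¹ * a n ^ (n ^ i * e + k) * t n ^ j := by
    intro e i j k
    have h : a n ^ e * (t n ^ i)⁻¹ = (t n ^ i)⁻¹ * a n ^ (n ^ i * e) := by
      rw [mul_inv_eq_iff_eq_mul, mul_assoc, ← tpow_mul, inv_mul_cancel_left]
    rw [← mul_assoc, ← mul_assoc, h, zpow_add]
    simp only [mul_assoc]
  have hmem : g ∈ Subgroup.closure (Set.range (PresentedGroup.of (rels := bsRels 1 n))) := by
    rw [PresentedGroup.closure_range_of]; trivial
  induction hmem using Subgroup.closure_induction_left with
  | one => exact ⟨0, 0, 0, by simp⟩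
  | mul_left x hx y _ ih =>
    obtain ⟨i, j, k, rfl⟩ := ih
    obtain ⟨l, rfl⟩ := hx
    fin_cases l
    · refine ⟨i, j, n ^ i * 1 + k, ?_⟩
      rw [← ha, zpow_one]; rfl
    · change ∃ (i' j' : ℕ) (k' : ℤ), t n * ((t n ^ i)⁻¹ * a n ^ k * t n ^ j) = _
      cases i with
      | zero =>
        refine ⟨0, j + 1, n * k, ?_⟩
        rw [pow_zero, inv_one, one_mul, one_mul, ← mul_assoc, t_mul, pow_succ', mul_assoc]
      | succ i =>
        refine ⟨i, j, k, ?_⟩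
        rw [pow_succ]; group
  | inv_mul_cancel x hx y _ ih =>
    obtain ⟨i, j, k, rfl⟩ := ih
    obtain ⟨l, rfl⟩ := hx
    fin_cases l
    · refine ⟨i, j, n ^ i * (-1) + k, ?_⟩
      rw [← ha, zpow_neg_one]; rfl
    · refine ⟨i + 1, j, k, ?_⟩
      change (t n)⁻¹ * _ = _
      rw [pow_succ, mul_inv_rev]
      simp only [mul_assoc]

/-- The `t`-exponent. -/
def τ (n : ℤ) : BaumslagSolitar 1 n →* Multiplicative ℤ :=
  PresentedGroup.toGroup (f := ![1, Multiplicative.ofAdd 1]) (by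
    rintro r rfl
    simp)

lemma τ_a (n : ℤ) : τ n (a n) = 1 := by simp [τ, a]

lemma τ_t (n : ℤ) : τ n (t n) = Multiplicative.ofAdd 1 := by simp [τ, t]

lemma addRight_zpow (k : ℤ) (x : ℚ) : ((Equiv.addRight (1 : ℚ)) ^ k) x = x + k := by
  simp

/-- The affine action on `ℚ`. -/
def Φ (n : ℤ) (hn : (n : ℚ) ≠ 0) : BaumslagSolitar 1 n →* Equiv.Perm ℚ :=
  PresentedGroup.toGroup (f := ![Equiv.addRight (1 : ℚ), Equiv.mulLeft₀ (n : ℚ) hn]) (by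
    rintro r rfl
    simp only [map_mul, map_inv, map_zpow, FreeGroup.lift_apply_of, Matrix.cons_val_zero,
      Matrix.cons_val_one, zpow_one]
    rw [mul_inv_eq_one]
    ext x
    rw [addRight_zpow]
    simp only [Equiv.Perm.mul_apply, Equiv.coe_addRight]
    change (n : ℚ) * ((Equiv.mulLeft₀ (n : ℚ) hn).symm x + 1) = x + n
    rw [mul_add, mul_one]
    congr 1
    exact (Equiv.mulLeft₀ (n : ℚ) hn).apply_symm_apply x)

lemma Φ_a (n : ℤ) (hn : (n : ℚ) ≠ 0) (x : ℚ) : Φ n hn (a n) x = x + 1 := by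
  simp [Φ, a]

lemma Φ_t (n : ℤ) (hn : (n : ℚ) ≠ 0) (x : ℚ) : Φ n hn (t n) x = n * x := by
  simp [Φ, t]

lemma Φ_affine (n : ℤ) (hn : (n : ℚ) ≠ 0) (b : BaumslagSolitar 1 n) (x : ℚ) :
    Φ n hn b x = (n : ℚ) ^ (Multiplicative.toAdd (τ n b)) * x + Φ n hn b 0 := by
  have hmem : b ∈ Subgroup.closure (Set.range (PresentedGroup.of (rels := bsRels 1 n))) := by
    rw [PresentedGroup.closure_range_of]; trivial
  induction hmem using Subgroup.closure_induction generalizing x with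
  | one => simp
  | mem b hb =>
    obtain ⟨l, rfl⟩ := hb
    fin_cases l
    · change Φ n hn (a n) x = (n : ℚ) ^ (Multiplicative.toAdd (τ n (a n))) * x + Φ n hn (a n) 0
      simp [Φ_a, τ_a]
    · change Φ n hn (t n) x = (n : ℚ) ^ (Multiplicative.toAdd (τ n (t n))) * x + Φ n hn (t n) 0
      simp [Φ_t, τ_t]
  | mul b c _ _ hb hc =>
    rw [map_mul, Equiv.Perm.mul_apply, Equiv.Perm.mul_apply, hb, hb (Φ n hn c 0), hc, map_mul,
      toAdd_mul, zpow_add₀ hn]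
    ring
  | inv b _ hb =>
    rw [map_inv, Equiv.Perm.inv_eq_iff_eq, hb, map_inv, toAdd_inv, zpow_neg]
    have h1 := hb ((Φ n hn b)⁻¹ 0)
    have h0 : Φ n hn b ((Φ n hn b)⁻¹ 0) = 0 := (Φ n hn b).apply_symm_apply 0
    rw [h0] at h1
    have h2 : (n : ℚ) ^ (Multiplicative.toAdd (τ n b)) ≠ 0 := zpow_ne_zero _ hn
    rw [mul_add, mul_inv_cancel_left₀ h2]
    linarith

/-- The translation part. -/
def φ (n : ℤ) (hn : (n : ℚ) ≠ 0) (b : BaumslagSolitar 1 n) : ℚ := Φ n hn b 0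

lemma φ_mul (n : ℤ) (hn : (n : ℚ) ≠ 0) (b c : BaumslagSolitar 1 n) :
    φ n hn (b * c) = (n : ℚ) ^ (Multiplicative.toAdd (τ n b)) * φ n hn c + φ n hn b := by
  unfold φ
  rw [map_mul, Equiv.Perm.mul_apply, Φ_affine n hn b]

lemma φ_one (n : ℤ) (hn : (n : ℚ) ≠ 0) : φ n hn 1 = 0 := by simp [φ]

lemma φ_a (n : ℤ) (hn : (n : ℚ) ≠ 0) : φ n hn (a n) = 1 := by simp [φ, Φ_a]

lemma φ_conj (n : ℤ) (hn : (n : ℚ) ≠ 0) (g b : BaumslagSolitar 1 n) (hb : τ n b = 1) :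
    φ n hn (g * b * g⁻¹) = (n : ℚ) ^ (Multiplicative.toAdd (τ n g)) * φ n hn b := by
  have h := φ_mul n hn g g⁻¹
  rw [mul_inv_cancel, φ_one] at h
  rw [φ_mul, φ_mul, map_mul, hb, mul_one]
  linarith

lemma φ_inj (n : ℤ) (hn : (n : ℚ) ≠ 0) (b : BaumslagSolitar 1 n) (hb : τ n b = 1)
    (h : φ n hn b = 0) : b = 1 := by
  obtain ⟨i, j, k, rfl⟩ := normal_form n b
  have hij : i = j := by
    have := congrArg Multiplicative.toAdd hb
    simp [τ_a, τ_t] at this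
    omega
  subst hij
  have hτ : τ n (a n ^ k) = 1 := by simp [τ_a]
  have h1 := φ_conj n hn ((t n ^ i)⁻¹) (a n ^ k) hτ
  rw [inv_inv, h] at h1
  have h2 := (mul_eq_zero.1 h1.symm).resolve_left (zpow_ne_zero _ hn)
  have h3 : φ n hn (a n ^ k) = k := by
    have : Φ n hn (a n) = Equiv.addRight (1 : ℚ) := Equiv.ext fun x => Φ_a n hn x
    unfold φ
    rw [map_zpow, this, addRight_zpow, zero_add]
  rw [h3] at h2
  have h4 : k = 0 := by exact_mod_cast h2
  simp [h4]

lemma zpow_n_inj (n : ℤ) (hn0 : n ≠ 0) (hn1 : n ≠ 1) (hn2 : n ≠ -1) {i j : ℤ}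
    (h : |(n : ℚ) ^ i| = |(n : ℚ) ^ j|) : i = j := by
  rw [abs_zpow, abs_zpow] at h
  refine zpow_right_injective₀ (a := |(n : ℚ)|) ?_ ?_ h
  · exact abs_pos.2 (by exact_mod_cast hn0)
  · intro h1
    rcases (abs_eq zero_le_one).1 h1 with h2 | h2
    · exact hn1 (by exact_mod_cast h2)
    · exact hn2 (by exact_mod_cast h2)

/-- Automorphisms preserve the `t`-exponent. -/
lemma τ_aut (n : ℤ) (hn0 : n ≠ 0) (hn1 : n ≠ 1) (hn2 : n ≠ -1)
    (α : MulAut (BaumslagSolitar 1 n)) (b : BaumslagSolitar 1 n) : τ n (α b) = τ n b := by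
  have hn : (n : ℚ) ≠ 0 := by exact_mod_cast hn0
  have hrel : α (t n) * α (a n) * (α (t n))⁻¹ = α (a n) ^ n := by
    rw [← map_mul, ← map_inv, ← map_mul, rel, map_zpow]
  have ha : τ n (α (a n)) = 1 := by
    have h := congrArg (fun x => Multiplicative.toAdd (τ n x)) hrel
    simp at h
    have h2 : (n - 1) * Multiplicative.toAdd (τ n (α (a n))) = 0 := by linarith
    have h3 := (mul_eq_zero.1 h2).resolve_left (by omega)
    exact Multiplicative.toAdd.injective h3
  have hφa : φ n hn (α (a n)) ≠ 0 := by
    intro h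
    have h1 := φ_inj n hn _ ha h
    have h2 : a n = 1 := by simpa using h1
    have h3 := φ_a n hn
    rw [h2, φ_one] at h3
    exact zero_ne_one h3
  have hpow : ∀ (x : BaumslagSolitar 1 n), τ n x = 1 → ∀ k : ℤ,
      φ n hn (x ^ k) = k * φ n hn x := by
    intro x hx
    have hadd : ∀ k : ℤ, φ n hn (x ^ (k + 1)) = φ n hn (x ^ k) + φ n hn x := by
      intro k
      rw [zpow_add, zpow_one, φ_mul, map_zpow, hx, one_zpow]
      simp [add_comm]
    intro k
    induction k using Int.induction_on with
    | zero => simp [φ_one]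
    | succ i ih => rw [hadd, ih]; push_cast; ring
    | pred i ih =>
      have := hadd (-(i : ℤ) - 1)
      rw [sub_add_cancel, ih] at this
      push_cast at this ⊢
      linarith
  have ht : τ n (α (t n)) = Multiplicative.ofAdd 1 := by
    have h := congrArg (φ n hn) hrel
    rw [φ_conj n hn _ _ ha, hpow _ ha] at h
    have h2 := mul_right_cancel₀ hφa h
    have h3 : Multiplicative.toAdd (τ n (α (t n))) = 1 := by
      apply zpow_n_inj n hn0 hn1 hn2
      rw [h2, zpow_one]
    exact Multiplicative.toAdd.injective h3
  have hhom : (τ n).comp α.toMonoidHom = τ n := by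
    apply PresentedGroup.ext
    intro l
    fin_cases l
    · exact ha.trans (τ_a n).symm
    · exact ht.trans (τ_t n).symm
  exact DFunLike.congr_fun hhom b

/-- The data for `BS(1,n) ⋊ ℤ`. -/
noncomputable def data (n : ℤ) (hn0 : n ≠ 0) (hn1 : n ≠ 1) (hn2 : n ≠ -1)
    (α : MulAut (BaumslagSolitar 1 n)) : AffData (zSemidirect (BaumslagSolitar 1 n) α) :=
  have hn : (n : ℚ) ≠ 0 := by exact_mod_cast hn0
  have hact : ∀ (g : Multiplicative ℤ) (b : BaumslagSolitar 1 n),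
      τ n (zAction α g b) = τ n b := fun g b => τ_aut n hn0 hn1 hn2 _ b
  AffData.ofBase
    { toFun := fun g => τ n g.left
      map_one' := by simp
      map_mul' := fun x y => by
        simp [hact] }
    SemidirectProduct.rightHom
    (fun g => φ n hn g.left)
    (by
      intro x y h1 h2 h3 h4
      change τ n x.left = 1 at h1
      change x.right = 1 at h2
      simp only [SemidirectProduct.mul_left, h2, map_one, MulAut.one_apply]
      rw [φ_mul, h1]
      simp [add_comm])
    (by
      intro x h1 h2 h3
      exact SemidirectProduct.ext (φ_inj n hn _ h1 h3) h2)
    (SemidirectProduct.inl (a n))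
    (by simp [τ_a]) (by simp) (by simp [φ_a])
    (by
      intro g h1 h2
      change g.right = 1 at h1
      change τ n g.left = 1
      simp only [SemidirectProduct.mul_left, SemidirectProduct.mul_right,
        SemidirectProduct.inv_left, SemidirectProduct.left_inl, SemidirectProduct.right_inl,
        h1, map_one, MulAut.one_apply, inv_one, mul_one] at h2
      rw [φ_conj n hn _ _ (τ_a n), φ_a, mul_one] at h2
      have h3 : Multiplicative.toAdd (τ n g.left) = 0 := by
        apply zpow_n_inj n hn0 hn1 hn2
        rw [h2]; simp
      exact Multiplicative.toAdd.injective h3)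

end BS

/-- Let `n ≠ 0, 1, -1`, `B = BS(1,n)` and `G = B ⋊_α ℤ`. Then every
finitely generated subgroup `S` of `G` satisfies `ω(S) ≥ 2^(1/24)`, unless `S` is
trivial, `ℤ`, `ℤ × ℤ`, or the Klein bottle group. -/
theorem statement12 (n : ℤ) (hn0 : n ≠ 0) (hn1 : n ≠ 1) (hn2 : n ≠ -1)
    (α : MulAut (BaumslagSolitar 1 n))
    (S : Subgroup (zSemidirect (BaumslagSolitar 1 n) α)) (hS : S.FG) :
    (2 : ℝ) ^ ((1 : ℝ) / 24) ≤ growthOmega ↥S ∨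
    Subsingleton ↥S ∨ Nonempty (↥S ≃* Multiplicative ℤ) ∨
    Nonempty (↥S ≃* Multiplicative (ℤ × ℤ)) ∨ Nonempty (↥S ≃* KleinBottleGroup) := by
  exact ((BS.data n hn0 hn1 hn2 α).restrict S).main ((Group.fg_iff_subgroup_fg S).2 hS)
end
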